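/- arXiv:1107.5968 — 5 statements merged into one kernel-verified Lean document; each statement's English description precedes it below -/
import Mathlib

section
/- Consider the linear time-varying system ẋ(t) = A(t)x(t) + G(t)w(t) with x(t₀) = 0 and output y(t) = C(t)x(t) on Ω = [t₀, t₀+T]. Let W : Ω → ℝ^{n×n} be the solution of the differential Lyapunov equation Ẇ(t) = A(t)W(t) + W(t)A(t)ᵀ + G(t)R(t)⁻¹G(t)ᵀ with W(t₀) = 0. If λ_max(Q(t)^{1/2} C(t) W(t) C(t)ᵀ Q(t)^{1/2}) < 1 for every t ∈ Ω, then the system is IO-FTS with respect to (W₂, Q(·), Ω); that is, for every input w ∈ W₂ and every locally absolutely continuous solution x of the system with x(t₀) = 0, the output satisfies y(t)ᵀQ(t)y(t) < 1 for all t ∈ Ω. -/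
open MeasureTheory Matrix Set

lemma aux_bound {n : ℕ} {a b : ℝ} (B : ℝ → Matrix (Fin n) (Fin n) ℝ)
    (hB : ∀ i j, ContinuousOn (fun t => B t i j) (Icc a b)) :
    ∃ M : ℝ, 0 ≤ M ∧ ∀ t ∈ Icc a b, ∀ y : Fin n → ℝ, ‖B t *ᵥ y‖ ≤ M * ‖y‖ := by
  have h : ∀ i j, ∃ c : ℝ, ∀ t ∈ Icc a b, ‖B t i j‖ ≤ c := fun i j =>
    isCompact_Icc.exists_bound_of_continuousOn (hB i j)
  choose c hc using h
  refine ⟨∑ i, ∑ j, |c i j|, by positivity, fun t ht y => ?_⟩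
  rw [pi_norm_le_iff_of_nonneg (by positivity)]
  intro i
  calc ‖(B t *ᵥ y) i‖ ≤ ∑ j, ‖B t i j * y j‖ := by
        simp only [mulVec, dotProduct]; exact norm_sum_le _ _
    _ ≤ ∑ j, |c i j| * ‖y‖ := by
        refine Finset.sum_le_sum fun j _ => ?_
        rw [norm_mul]
        exact mul_le_mul ((hc i j t ht).trans (le_abs_self _)) (norm_le_pi_norm y j)
          (norm_nonneg _) (abs_nonneg _)
    _ = (∑ j, |c i j|) * ‖y‖ := by rw [Finset.sum_mul]
    _ ≤ _ := by
        refine mul_le_mul_of_nonneg_right ?_ (norm_nonneg _)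
        exact Finset.single_le_sum (f := fun i => ∑ j, |c i j|)
          (fun i _ => by positivity) (Finset.mem_univ i)

lemma aux_ode_fwd {n : ℕ} {a b : ℝ} (hab : a ≤ b) (B : ℝ → Matrix (Fin n) (Fin n) ℝ)
    (hB : ∀ i j, ContinuousOn (fun t => B t i j) (Icc a b)) (v : Fin n → ℝ) :
    ∃ p : ℝ → Fin n → ℝ, p a = v ∧
      ∀ t ∈ Icc a b, HasDerivWithinAt p (B t *ᵥ p t) (Icc a b) t := by
  obtain ⟨M, hM0, hM⟩ := aux_bound B hB
  set D : ℝ := ‖v‖ * Real.exp (M * (b - a)) with hD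
  have hD0 : 0 ≤ D := by positivity
  let ψ : (Fin n → ℝ) → (Fin n → ℝ) := fun y i => max (-D) (min D (y i))
  have hψ1 : ∀ y, ‖ψ y‖ ≤ D := fun y => by
    rw [pi_norm_le_iff_of_nonneg hD0]
    intro i
    rw [Real.norm_eq_abs, abs_le]
    exact ⟨le_max_left _ _, max_le (by linarith) (min_le_left _ _)⟩
  have hψ2 : ∀ y, ‖ψ y‖ ≤ ‖y‖ := fun y => by
    rw [pi_norm_le_iff_of_nonneg (norm_nonneg _)]
    intro i
    refine le_trans ?_ (norm_le_pi_norm y i)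
    simp only [ψ, Real.norm_eq_abs]
    grind
  have hψ3 : ∀ y z, ‖ψ y - ψ z‖ ≤ ‖y - z‖ := fun y z => by
    rw [pi_norm_le_iff_of_nonneg (norm_nonneg _)]
    intro i
    refine le_trans ?_ (norm_le_pi_norm (y - z) i)
    simp only [ψ, Real.norm_eq_abs, Pi.sub_apply]
    grind
  have hψ4 : ∀ y, ‖y‖ ≤ D → ψ y = y := fun y hy => by
    funext i
    have := (norm_le_pi_norm y i).trans hy
    rw [Real.norm_eq_abs, abs_le] at this
    simp only [ψ]
    rw [min_eq_right this.2, max_eq_right this.1]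
  have hPL : IsPicardLindelof (fun t y => B t *ᵥ ψ y) (tmin := a) (tmax := b)
      ⟨a, left_mem_Icc.2 hab⟩ v ⟨M * D * (b - a), by have := sub_nonneg.2 hab; positivity⟩ 0
      ⟨M * D, by positivity⟩ ⟨M, hM0⟩ := by
    refine ⟨fun t ht => ?_, fun y _ => ?_, fun t ht y _ => ?_, ?_⟩
    · refine LipschitzOnWith.of_dist_le_mul fun y _ z _ => ?_
      rw [dist_eq_norm, dist_eq_norm, ← mulVec_sub]
      exact (hM t ht _).trans (mul_le_mul_of_nonneg_left (hψ3 y z) hM0)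
    · rw [continuousOn_pi]
      intro i
      simp only [mulVec, dotProduct]
      exact continuousOn_finsetSum _ fun j _ => (hB i j).mul continuousOn_const
    · exact (hM t ht _).trans (mul_le_mul_of_nonneg_left (hψ1 y) hM0)
    · simp only [sub_self, max_eq_left (sub_nonneg.2 hab), NNReal.coe_zero, sub_zero]
      exact le_refl (M * D * (b - a))
  obtain ⟨p, hp0, hp⟩ := hPL.exists_eq_forall_mem_Icc_hasDerivWithinAt₀
  simp only at hp0
  refine ⟨p, hp0, fun t ht => ?_⟩
  have hgr := norm_le_gronwallBound_of_norm_deriv_right_le (f := p)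
    (f' := fun t => B t *ᵥ ψ (p t)) (δ := ‖v‖) (K := M) (ε := 0) (a := a) (b := b)
    (fun t ht => (hp t ht).continuousWithinAt)
    (fun t ht => (hp t (Ico_subset_Icc_self ht)).mono_of_mem_nhdsWithin
      (Icc_mem_nhdsGE_of_mem ht)) (by rw [hp0])
    (fun t ht => by
      rw [add_zero]
      exact (hM t (Ico_subset_Icc_self ht) _).trans (mul_le_mul_of_nonneg_left (hψ2 _) hM0)) t ht
  rw [gronwallBound_ε0] at hgr
  have h2 : ‖p t‖ ≤ D := hgr.trans (by
    have := ht.2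
    rw [hD]
    gcongr)
  have := hp t ht
  rwa [hψ4 _ h2] at this

lemma aux_ode_bwd {n : ℕ} {a b : ℝ} (hab : a ≤ b) (B : ℝ → Matrix (Fin n) (Fin n) ℝ)
    (hB : ∀ i j, ContinuousOn (fun t => B t i j) (Icc a b)) (v : Fin n → ℝ) :
    ∃ p : ℝ → Fin n → ℝ, p b = v ∧
      ∀ t ∈ Icc a b, HasDerivWithinAt p (-(B t *ᵥ p t)) (Icc a b) t := by
  have hmap : MapsTo (fun t => a + b - t) (Icc a b) (Icc a b) := fun t ht =>
    ⟨by linarith [ht.2], by linarith [ht.1]⟩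
  obtain ⟨q, hq0, hq⟩ := aux_ode_fwd hab (fun t => B (a + b - t))
    (fun i j => (hB i j).comp (by fun_prop) hmap) v
  refine ⟨fun t => q (a + b - t), by simpa using hq0, fun t ht => ?_⟩
  have h1 := hq (a + b - t) (hmap ht)
  have h2 : HasDerivWithinAt (fun t : ℝ => a + b - t) (-1) (Icc a b) t := by
    simpa using (hasDerivWithinAt_id t (Icc a b)).const_sub (a + b)
  have h3 := h1.scomp t h2 hmap
  simpa [Function.comp_def] using h3

/-- integration by parts -/
lemma aux_ibp {a b : ℝ} (hab : a ≤ b) (u u' f X : ℝ → ℝ)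
    (hu : ∀ t ∈ Icc a b, HasDerivWithinAt u (u' t) (Icc a b) t)
    (hu' : ContinuousOn u' (Icc a b))
    (hf : IntervalIntegrable f volume a b)
    (hX : ∀ t ∈ Icc a b, X t = ∫ τ in a..t, f τ) :
    IntervalIntegrable (fun t => u' t * X t + u t * f t) volume a b ∧
    ∫ t in a..b, (u' t * X t + u t * f t) = u b * X b := by
  have hcu : ContinuousOn u (Icc a b) := fun t ht => (hu t ht).continuousWithinAt
  have hI : uIcc a b = Icc a b := uIcc_of_le hab
  have hi' : IntervalIntegrable u' volume a b := ContinuousOn.intervalIntegrable (hI ▸ hu')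
  have hXac := hf.absolutelyContinuousOnInterval_intervalIntegral (c := a) (by simp)
  have hUac := (ContDiffOn.absolutelyContinuousOnInterval (f := fun _ : ℝ => u a) (a := a) (b := b)
      contDiffOn_const).fun_add
    (hi'.absolutelyContinuousOnInterval_intervalIntegral (c := a) (by simp))
  have hUeq : ∀ t ∈ Icc a b, u a + ∫ τ in a..t, u' τ = u t := fun t ht => by
    have hsub : Icc a t ⊆ Icc a b := Icc_subset_Icc_right ht.2
    rw [intervalIntegral.integral_eq_sub_of_hasDerivAt_of_le ht.1 (hcu.mono hsub)
      (fun s hs => (hu s (hsub (Ioo_subset_Icc_self hs))).hasDerivAt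
        (Icc_mem_nhds hs.1 (hs.2.trans_le ht.2)))
      (ContinuousOn.intervalIntegrable (by rw [uIcc_of_le ht.1]; exact hu'.mono hsub))]
    ring
  have hcX : ContinuousOn X (Icc a b) :=
    (hI ▸ hXac.continuousOn).congr fun t ht => hX t ht
  constructor
  · exact (hi'.mul_continuousOn (hI ▸ hcX)).add (hf.continuousOn_mul (hI ▸ hcu))
  have key := hUac.integral_deriv_mul_eq_sub hXac
  simp only [intervalIntegral.integral_same, mul_zero, sub_zero] at key
  rw [hUeq b (right_mem_Icc.2 hab), ← hX b (right_mem_Icc.2 hab)] at key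
  rw [← key]
  apply intervalIntegral.integral_congr_ae
  filter_upwards [hi'.ae_hasDerivAt_integral, hf.ae_hasDerivAt_integral] with t h1 h2 h3
  have h4 : t ∈ uIcc a b := uIoc_subset_uIcc h3
  rw [(h2 h4 a (by simp)).deriv, ((h1 h4 a (by simp)).const_add (u a)).deriv,
    hUeq t (hI ▸ h4), ← hX t (hI ▸ h4)]

lemma aux_eig {m : ℕ} (M : Matrix (Fin m) (Fin m) ℝ) (hM : M.IsHermitian)
    (h : ∀ i, hM.eigenvalues i < 1) (z : Fin m → ℝ) (hz : z ≠ 0) :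
    z ⬝ᵥ (M *ᵥ z) < z ⬝ᵥ z := by
  have hpd : (1 - M).PosDef := by
    have : 1 - M = Unitary.conjStarAlgAut ℝ _ hM.eigenvectorUnitary
        (diagonal fun i => 1 - hM.eigenvalues i) := by
      conv_lhs => rw [hM.spectral_theorem]
      have h1 : (diagonal fun i => 1 - hM.eigenvalues i) =
        (1 : Matrix (Fin m) (Fin m) ℝ) - Matrix.diagonal (RCLike.ofReal ∘ hM.eigenvalues) := by
        rw [← diagonal_one, diagonal_sub]; rfl
      rw [h1, map_sub, map_one]
    rw [this]
    simp [Unitary.isUnit_coe.posDef_star_right_conjugate_iff]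
    exact h
  have := hpd.dotProduct_mulVec_pos hz
  simp [sub_mulVec] at this
  exact this

lemma aux_inv {r : ℕ} {s : Set ℝ} (R : ℝ → Matrix (Fin r) (Fin r) ℝ)
    (hR : ∀ i j, ContinuousOn (fun t => R t i j) s) (h : ∀ t ∈ s, (R t).PosDef) (i j) :
    ContinuousOn (fun t => (R t)⁻¹ i j) s := by
  have hc : ContinuousOn R s := by
    exact continuousOn_pi.2 fun i => continuousOn_pi.2 (hR i)
  rw [continuousOn_iff_continuous_domRestrict] at hc ⊢
  have hd : Continuous fun t : s => (R t).det := Continuous.matrix_det hc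
  have ha : Continuous fun t : s => (R t).adjugate := Continuous.matrix_adjugate hc
  have : (s.domRestrict fun t => (R t)⁻¹ i j) = fun t : s => (R t).det⁻¹ * (R t).adjugate i j := by
    funext t
    simp [Matrix.inv_def, Ring.inverse_eq_inv']
  refine this ▸ ?_
  exact (hd.inv₀ fun t => (h t t.2).det_pos.ne').mul (ha.matrix_elem i j)

lemma aux_young {r : ℕ} (R : Matrix (Fin r) (Fin r) ℝ) (hR : R.PosDef) (g w : Fin r → ℝ) (c : ℝ) :
    2 * c * (g ⬝ᵥ w) ≤ g ⬝ᵥ (R⁻¹ *ᵥ g) + c ^ 2 * (w ⬝ᵥ (R *ᵥ w)) := by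
  have h := hR.posSemidef.dotProduct_mulVec_nonneg (R⁻¹ *ᵥ g - c • w)
  have hu : IsUnit R.det := hR.det_pos.ne'.isUnit
  have hs : Rᵀ = R := by rw [← conjTranspose_eq_transpose_of_trivial]; exact hR.1
  have e1 : R *ᵥ (R⁻¹ *ᵥ g) = g := by rw [mulVec_mulVec, mul_nonsing_inv _ hu, one_mulVec]
  have e2 : (R⁻¹ *ᵥ g) ⬝ᵥ (R *ᵥ w) = g ⬝ᵥ w := by
    rw [dotProduct_mulVec, ← mulVec_transpose, hs, e1]
  simp only [star_trivial, mulVec_sub, mulVec_smul, e1, sub_dotProduct, dotProduct_sub,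
    smul_dotProduct, dotProduct_smul, e2, smul_eq_mul] at h
  rw [dotProduct_comm (R⁻¹ *ᵥ g) g, dotProduct_comm w g] at h
  nlinarith

lemma aux_hd_dot {k : ℕ} {s : Set ℝ} {t : ℝ} {u v : ℝ → Fin k → ℝ} {u' v' : Fin k → ℝ}
    (hu : ∀ i, HasDerivWithinAt (fun t => u t i) (u' i) s t)
    (hv : ∀ i, HasDerivWithinAt (fun t => v t i) (v' i) s t) :
    HasDerivWithinAt (fun t => u t ⬝ᵥ v t) (u' ⬝ᵥ v t + u t ⬝ᵥ v') s t := by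
  simp only [dotProduct, ← Finset.sum_add_distrib]
  exact HasDerivWithinAt.fun_sum fun i _ => (hu i).mul (hv i)

lemma aux_co_dot {k : ℕ} {s : Set ℝ} {u v : ℝ → Fin k → ℝ}
    (hu : ∀ i, ContinuousOn (fun t => u t i) s)
    (hv : ∀ i, ContinuousOn (fun t => v t i) s) :
    ContinuousOn (fun t => u t ⬝ᵥ v t) s := by
  simp only [dotProduct]
  exact continuousOn_finsetSum _ fun i _ => (hu i).mul (hv i)

lemma aux_W {n r : ℕ} {a b : ℝ} (hab : a ≤ b)
    (A : ℝ → Matrix (Fin n) (Fin n) ℝ)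
    (G : ℝ → Matrix (Fin n) (Fin r) ℝ)
    (R : ℝ → Matrix (Fin r) (Fin r) ℝ)
    (hG : ∀ i j, ContinuousOn (fun t => G t i j) (Icc a b))
    (hR : ∀ i j, ContinuousOn (fun t => R t i j) (Icc a b))
    (hRpd : ∀ t ∈ Icc a b, (R t).PosDef)
    (W : ℝ → Matrix (Fin n) (Fin n) ℝ) (hW0 : W a = 0)
    (hWode : ∀ t ∈ Icc a b, ∀ i j,
      HasDerivWithinAt (fun s => W s i j)
        ((A t * W t + W t * (A t)ᵀ + G t * (R t)⁻¹ * (G t)ᵀ) i j) (Icc a b) t)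
    (p q : ℝ → Fin n → ℝ)
    (hp : ∀ t ∈ Icc a b, HasDerivWithinAt p (-((A t)ᵀ *ᵥ p t)) (Icc a b) t)
    (hq : ∀ t ∈ Icc a b, HasDerivWithinAt q (-((A t)ᵀ *ᵥ q t)) (Icc a b) t) :
    IntervalIntegrable (fun t => ((G t)ᵀ *ᵥ p t) ⬝ᵥ ((R t)⁻¹ *ᵥ ((G t)ᵀ *ᵥ q t))) volume a b ∧
    ∫ t in a..b, ((G t)ᵀ *ᵥ p t) ⬝ᵥ ((R t)⁻¹ *ᵥ ((G t)ᵀ *ᵥ q t)) = p b ⬝ᵥ (W b *ᵥ q b) := by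
  have hpi := fun t ht => hasDerivWithinAt_pi.1 (hp t ht)
  have hqi := fun t ht => hasDerivWithinAt_pi.1 (hq t ht)
  have cp : ∀ i, ContinuousOn (fun t => p t i) (Icc a b) :=
    fun i t ht => (hpi t ht i).continuousWithinAt
  have cq : ∀ i, ContinuousOn (fun t => q t i) (Icc a b) :=
    fun i t ht => (hqi t ht i).continuousWithinAt
  have hint : IntervalIntegrable
      (fun t => ((G t)ᵀ *ᵥ p t) ⬝ᵥ ((R t)⁻¹ *ᵥ ((G t)ᵀ *ᵥ q t))) volume a b := by
    apply ContinuousOn.intervalIntegrable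
    rw [uIcc_of_le hab]
    exact aux_co_dot (fun i => aux_co_dot (fun j => hG j i) cp) (fun i =>
      aux_co_dot (fun j => aux_inv R hR hRpd i j) (fun j => aux_co_dot (fun k => hG k j) cq))
  refine ⟨hint, ?_⟩
  have hder : ∀ t ∈ Icc a b, HasDerivWithinAt (fun t => p t ⬝ᵥ (W t *ᵥ q t))
      (((G t)ᵀ *ᵥ p t) ⬝ᵥ ((R t)⁻¹ *ᵥ ((G t)ᵀ *ᵥ q t))) (Icc a b) t := by
    intro t ht
    have h1 := aux_hd_dot (hpi t ht)
      (v := fun t => W t *ᵥ q t)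
      (v' := (A t * W t + W t * (A t)ᵀ + G t * (R t)⁻¹ * (G t)ᵀ) *ᵥ q t +
        W t *ᵥ (-((A t)ᵀ *ᵥ q t)))
      (fun i => aux_hd_dot (u := fun t => W t i) (hWode t ht i) (hqi t ht))
    convert h1 using 1
    have e : ∀ (k : ℕ) (B : Matrix (Fin n) (Fin k) ℝ) (y z),
        ((B)ᵀ *ᵥ y) ⬝ᵥ z = y ⬝ᵥ (B *ᵥ z) := fun k B y z => by
      rw [mulVec_transpose, dotProduct_mulVec]
    simp only [neg_dotProduct, e, mulVec_neg, add_mulVec, dotProduct_add, dotProduct_neg,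
      mulVec_mulVec, Matrix.mul_assoc]
    ring
  rw [intervalIntegral.integral_eq_sub_of_hasDerivAt_of_le hab
    (fun t ht => (hder t ht).continuousWithinAt)
    (fun t ht => (hder t (Ioo_subset_Icc_self ht)).hasDerivAt (Icc_mem_nhds ht.1 ht.2)) hint]
  simp [hW0]

lemma aux_x {n r : ℕ} {a b : ℝ} (hab : a ≤ b)
    (A : ℝ → Matrix (Fin n) (Fin n) ℝ)
    (G : ℝ → Matrix (Fin n) (Fin r) ℝ)
    (hA : ∀ i j, ContinuousOn (fun t => A t i j) (Icc a b))
    (p : ℝ → Fin n → ℝ)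
    (hp : ∀ t ∈ Icc a b, HasDerivWithinAt p (-((A t)ᵀ *ᵥ p t)) (Icc a b) t)
    (w : ℝ → Fin r → ℝ) (x : ℝ → Fin n → ℝ)
    (hx : ∀ t ∈ Icc a b,
          IntervalIntegrable (fun τ => A τ *ᵥ x τ + G τ *ᵥ w τ) volume a t ∧
          x t = ∫ τ in a..t, (A τ *ᵥ x τ + G τ *ᵥ w τ)) :
    IntervalIntegrable (fun t => ((G t)ᵀ *ᵥ p t) ⬝ᵥ w t) volume a b ∧
    ∫ t in a..b, ((G t)ᵀ *ᵥ p t) ⬝ᵥ w t = p b ⬝ᵥ x b := by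
  have hpi := fun t ht => hasDerivWithinAt_pi.1 (hp t ht)
  have cp : ∀ i, ContinuousOn (fun t => p t i) (Icc a b) :=
    fun i t ht => (hpi t ht i).continuousWithinAt
  have hfi : ∀ t ∈ Icc a b, ∀ i,
      IntervalIntegrable (fun τ => (A τ *ᵥ x τ + G τ *ᵥ w τ) i) volume a t := fun t ht i => by
    have := (hx t ht).1
    rw [intervalIntegrable_iff] at this ⊢
    exact this.eval i
  have hxi : ∀ i, ∀ t ∈ Icc a b, x t i = ∫ τ in a..t, (A τ *ᵥ x τ + G τ *ᵥ w τ) i := by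
    intro i t ht
    have h := congrFun (hx t ht).2 i
    rw [h]
    exact ((ContinuousLinearMap.proj (R := ℝ) (φ := fun _ : Fin n => ℝ) i).intervalIntegral_comp_comm
      (hx t ht).1).symm
  have key := fun i => aux_ibp hab (fun t => p t i) (fun t => (-((A t)ᵀ *ᵥ p t)) i)
    (fun τ => (A τ *ᵥ x τ + G τ *ᵥ w τ) i) (fun t => x t i) (fun t ht => hpi t ht i)
    (aux_co_dot (fun j => hA j i) cp).neg (hfi b (right_mem_Icc.2 hab) i) (hxi i)
  have e : (fun t => ((G t)ᵀ *ᵥ p t) ⬝ᵥ w t) = fun t => ∑ i,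
      ((-((A t)ᵀ *ᵥ p t)) i * x t i + p t i * (A t *ᵥ x t + G t *ᵥ w t) i) := by
    funext t
    rw [Finset.sum_add_distrib]
    change _ = (-((A t)ᵀ *ᵥ p t)) ⬝ᵥ x t + p t ⬝ᵥ (A t *ᵥ x t + G t *ᵥ w t)
    rw [neg_dotProduct, dotProduct_add, mulVec_transpose, mulVec_transpose, dotProduct_mulVec,
      dotProduct_mulVec]
    ring
  rw [e]
  constructor
  · have := IntervalIntegrable.sum Finset.univ (fun i _ => (key i).1)
    rw [Finset.sum_fn] at this
    exact this
  · rw [intervalIntegral.integral_finsetSum (fun i _ => (key i).1)]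
    exact Finset.sum_congr rfl fun i _ => (key i).2

/-- **Sufficiency of the Gramian eigenvalue condition for IO-FTS w.r.t. W₂ inputs.**
If `W` solves the differential Lyapunov equation
`Ẇ(t) = A(t)W(t) + W(t)A(t)ᵀ + G(t)R(t)⁻¹G(t)ᵀ`, `W(t₀) = 0`, and
`λ_max(Q(t)^{1/2} C(t) W(t) C(t)ᵀ Q(t)^{1/2}) < 1` on `Ω = [t₀, t₀+T]`, then the system
`ẋ = A x + G w`, `x(t₀) = 0`, `y = C x` is IO-FTS with respect to `(W₂, Q(·), Ω)`. -/
theorem io_fts_of_gramian_eigenvalue_lt_one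
    {n r m : ℕ} (t₀ T : ℝ) (hT : 0 < T)
    (A : ℝ → Matrix (Fin n) (Fin n) ℝ)
    (G : ℝ → Matrix (Fin n) (Fin r) ℝ)
    (C : ℝ → Matrix (Fin m) (Fin n) ℝ)
    (R : ℝ → Matrix (Fin r) (Fin r) ℝ)
    (Q : ℝ → Matrix (Fin m) (Fin m) ℝ)
    (hA : ∀ i j, ContinuousOn (fun t => A t i j) (Icc t₀ (t₀ + T)))
    (hG : ∀ i j, ContinuousOn (fun t => G t i j) (Icc t₀ (t₀ + T)))
    (hC : ∀ i j, ContinuousOn (fun t => C t i j) (Icc t₀ (t₀ + T)))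
    (hR : ∀ i j, ContinuousOn (fun t => R t i j) (Icc t₀ (t₀ + T)))
    (hQ : ∀ i j, ContinuousOn (fun t => Q t i j) (Icc t₀ (t₀ + T)))
    (hRpd : ∀ t ∈ Icc t₀ (t₀ + T), (R t).PosDef)
    (hQpd : ∀ t ∈ Icc t₀ (t₀ + T), (Q t).PosDef)
    -- `W` is the solution of the differential Lyapunov equation with `W(t₀) = 0`
    (W : ℝ → Matrix (Fin n) (Fin n) ℝ)
    (hW0 : W t₀ = 0)
    (hWode : ∀ t ∈ Icc t₀ (t₀ + T), ∀ i j,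
      HasDerivWithinAt (fun s => W s i j)
        ((A t * W t + W t * (A t)ᵀ + G t * (R t)⁻¹ * (G t)ᵀ) i j)
        (Icc t₀ (t₀ + T)) t)
    -- `Qs t` is the symmetric positive definite square root of `Q t`
    (Qs : ℝ → Matrix (Fin m) (Fin m) ℝ)
    (hQs : ∀ t ∈ Icc t₀ (t₀ + T), (Qs t).PosDef ∧ Qs t * Qs t = Q t)
    -- the eigenvalue condition: `λ_max(Q^{1/2} C W Cᵀ Q^{1/2}) < 1` on `Ω`
    (hEig : ∀ t ∈ Icc t₀ (t₀ + T),
      ∀ hHerm : (Qs t * C t * W t * (C t)ᵀ * Qs t).IsHermitian,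
        ∀ i, hHerm.eigenvalues i < 1) :
    -- IO-FTS with respect to `(W₂, Q(·), Ω)`
    ∀ w : ℝ → Fin r → ℝ, Measurable w →
      IntervalIntegrable (fun τ => w τ ⬝ᵥ (R τ *ᵥ w τ)) volume t₀ (t₀ + T) →
      (∫ τ in t₀..(t₀ + T), w τ ⬝ᵥ (R τ *ᵥ w τ)) ≤ 1 →
      ∀ x : ℝ → Fin n → ℝ,
        (∀ t ∈ Icc t₀ (t₀ + T),
          IntervalIntegrable (fun τ => A τ *ᵥ x τ + G τ *ᵥ w τ) volume t₀ t ∧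
          x t = ∫ τ in t₀..t, (A τ *ᵥ x τ + G τ *ᵥ w τ)) →
        ∀ t ∈ Icc t₀ (t₀ + T), (C t *ᵥ x t) ⬝ᵥ (Q t *ᵥ (C t *ᵥ x t)) < 1 := by
  intro w _ hwi hw1 x hx t ht
  have hsub : Icc t₀ t ⊆ Icc t₀ (t₀ + T) := Icc_subset_Icc_right ht.2
  have hex := aux_ode_bwd ht.1 (fun t => (A t)ᵀ) (fun i j => (hA j i).mono hsub)
  have hWr : ∀ s ∈ Icc t₀ t, ∀ i j, HasDerivWithinAt (fun s => W s i j)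
        ((A s * W s + W s * (A s)ᵀ + G s * (R s)⁻¹ * (G s)ᵀ) i j) (Icc t₀ t) s :=
    fun s hs i j => (hWode s (hsub hs) i j).mono hsub
  have hWint := aux_W ht.1 A G R (fun i j => (hG i j).mono hsub) (fun i j => (hR i j).mono hsub)
    (fun s hs => hRpd s (hsub hs)) W hW0 hWr
  -- symmetry of `W t`
  have hsymm : ∀ u v : Fin n → ℝ, u ⬝ᵥ (W t *ᵥ v) = v ⬝ᵥ (W t *ᵥ u) := by
    intro u v
    obtain ⟨p, hp0, hp⟩ := hex u
    obtain ⟨q, hq0, hq⟩ := hex v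
    have h1 := (hWint p q hp hq).2
    have h2 := (hWint q p hq hp).2
    rw [hp0, hq0] at h1 h2
    rw [← h1, ← h2]
    apply intervalIntegral.integral_congr
    intro s hs
    rw [uIcc_of_le ht.1] at hs
    have hs' : ((R s)⁻¹)ᵀ = (R s)⁻¹ := by
      rw [← conjTranspose_eq_transpose_of_trivial]
      exact (hRpd s (hsub hs)).1.inv
    simp only
    rw [dotProduct_mulVec, ← mulVec_transpose, hs', dotProduct_comm]
  have hWT : (W t)ᵀ = W t := by
    ext i j
    have := hsymm (Pi.single j 1) (Pi.single i 1)
    simpa using this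
  obtain ⟨hQsp, hQsq⟩ := hQs t ht
  have hQsT : (Qs t)ᵀ = Qs t := by
    rw [← conjTranspose_eq_transpose_of_trivial]; exact hQsp.1
  have hHerm : (Qs t * C t * W t * (C t)ᵀ * Qs t).IsHermitian := by
    rw [Matrix.IsHermitian, conjTranspose_eq_transpose_of_trivial]
    simp only [transpose_mul, transpose_transpose, hQsT, hWT, Matrix.mul_assoc]
  have hlt := aux_eig _ hHerm (hEig t ht hHerm)
  set z := Qs t *ᵥ (C t *ᵥ x t) with hz
  have hgoal : (C t *ᵥ x t) ⬝ᵥ (Q t *ᵥ (C t *ᵥ x t)) = z ⬝ᵥ z := by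
    rw [← hQsq, ← mulVec_mulVec, dotProduct_mulVec, ← mulVec_transpose, hQsT]
  rw [hgoal]
  by_cases hz0 : z = 0
  · simp [hz0]
  have hlt := hlt z hz0
  set v := (C t)ᵀ *ᵥ (Qs t *ᵥ z) with hv
  have hvx : v ⬝ᵥ x t = z ⬝ᵥ z := by
    rw [hv, mulVec_transpose, ← dotProduct_mulVec]
    nth_rw 1 [← hQsT]
    rw [mulVec_transpose, ← dotProduct_mulVec]
  have hvW : v ⬝ᵥ (W t *ᵥ v) = z ⬝ᵥ ((Qs t * C t * W t * (C t)ᵀ * Qs t) *ᵥ z) := by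
    have : (Qs t * C t * W t * (C t)ᵀ * Qs t) *ᵥ z = Qs t *ᵥ (C t *ᵥ (W t *ᵥ v)) := by
      simp only [hv, mulVec_mulVec, Matrix.mul_assoc]
    rw [this]
    conv_lhs => rw [hv]
    rw [mulVec_transpose, ← dotProduct_mulVec]
    nth_rw 1 [← hQsT]
    rw [mulVec_transpose, ← dotProduct_mulVec, ← mulVec_transpose]
  obtain ⟨p, hp0, hp⟩ := hex v
  obtain ⟨hi1, h1⟩ := hWint p p hp hp
  obtain ⟨hi2, h2⟩ := aux_x ht.1 A G (fun i j => (hA i j).mono hsub) p hp w x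
    (fun s hs => hx s (hsub hs))
  rw [hp0, hvW] at h1
  rw [hp0, hvx] at h2
  have h0T : t₀ ≤ t₀ + T := by linarith
  have hwi' : IntervalIntegrable (fun τ => w τ ⬝ᵥ (R τ *ᵥ w τ)) volume t₀ t :=
    hwi.mono_set (by rw [uIcc_of_le ht.1, uIcc_of_le h0T]; exact hsub)
  have hwi'' : IntervalIntegrable (fun τ => w τ ⬝ᵥ (R τ *ᵥ w τ)) volume t (t₀ + T) :=
    hwi.mono_set (by
      rw [uIcc_of_le ht.2, uIcc_of_le h0T]; exact Icc_subset_Icc_left ht.1)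
  have hb : ∫ τ in t₀..t, w τ ⬝ᵥ (R τ *ᵥ w τ) ≤ 1 := by
    have h3 := intervalIntegral.integral_add_adjacent_intervals hwi' hwi''
    have h4 : 0 ≤ ∫ τ in t..(t₀ + T), w τ ⬝ᵥ (R τ *ᵥ w τ) :=
      intervalIntegral.integral_nonneg ht.2 fun s hs => by
        simpa using (hRpd s ⟨ht.1.trans hs.1, hs.2⟩).posSemidef.dotProduct_mulVec_nonneg (w s)
    linarith
  set N := z ⬝ᵥ z with hN
  have hmono := intervalIntegral.integral_mono_on ht.1 (hi2.const_mul (2 * N))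
    (hi1.add (hwi'.const_mul (N ^ 2)))
    (fun s hs => aux_young (R s) (hRpd s (hsub hs)) ((G s)ᵀ *ᵥ p s) (w s) N)
  rw [intervalIntegral.integral_add hi1 (hwi'.const_mul (N ^ 2)),
    intervalIntegral.integral_const_mul, intervalIntegral.integral_const_mul, h1, h2] at hmono
  by_contra hcon
  push Not at hcon
  nlinarith [mul_le_mul_of_nonneg_left hb (sq_nonneg N)]
end

section
/- Consider the linear time-varying system ẋ(t) = A(t)x(t) + G(t)w(t) with x(t₀) = 0 and output y(t) = C(t)x(t) on Ω = [t₀, t₀+T]. Suppose there exists a continuously differentiable symmetric positive definite matrix-valued function P : Ω → ℝ^{n×n} such that for every t ∈ Ω the block matrix [[Ṗ(t) + A(t)ᵀP(t) + P(t)A(t), P(t)G(t)], [G(t)ᵀP(t), −R(t)]] is negative definite and P(t) − C(t)ᵀQ(t)C(t) is positive definite. Then the system is IO-FTS with respect to (W₂, Q(·), Ω): for every w ∈ W₂, the output satisfies y(t)ᵀQ(t)y(t) < 1 for all t ∈ Ω. -/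
open MeasureTheory Matrix Set

lemma ac_finset_sum {ι : Type*} (s : Finset ι) (f : ι → ℝ → ℝ) (a b : ℝ)
    (h : ∀ i ∈ s, AbsolutelyContinuousOnInterval (f i) a b) :
    AbsolutelyContinuousOnInterval (fun t => ∑ i ∈ s, f i t) a b := by
  classical
  induction s using Finset.induction_on with
  | empty =>
    simp only [Finset.sum_empty]
    exact (LipschitzWith.const (0:ℝ)).lipschitzOnWith.absolutelyContinuousOnInterval
  | insert i s hi ih =>
    have := (h i (by simp)).add (ih fun j hj => h j (by simp [hj]))
    have he : (fun t => ∑ i ∈ insert i s, f i t) = f i + fun t => ∑ i ∈ s, f i t := by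
      funext t
      simp [Finset.sum_insert hi]
    rw [he]
    exact this

lemma ac_of_deriv (a b : ℝ) (hab : a ≤ b) (f f' : ℝ → ℝ) (hc : ContinuousOn f' (Icc a b))
    (hd : ∀ t ∈ Icc a b, HasDerivWithinAt f (f' t) (Icc a b) t) :
    AbsolutelyContinuousOnInterval f a b := by
  obtain ⟨K, hK⟩ := isCompact_Icc.exists_bound_of_continuousOn hc
  have : LipschitzOnWith K.toNNReal f (Icc a b) := by
    refine (convex_Icc a b).lipschitzOnWith_of_nnnorm_hasDerivWithin_le hd ?_
    intro t ht
    rw [← NNReal.coe_le_coe, coe_nnnorm]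
    exact (hK t ht).trans (Real.le_coe_toNNReal K)
  rw [← uIcc_of_le hab] at this
  exact this.absolutelyContinuousOnInterval

lemma dlmi_alg {n r : ℕ} (A P P' : Matrix (Fin n) (Fin n) ℝ) (G : Matrix (Fin n) (Fin r) ℝ)
    (R : Matrix (Fin r) (Fin r) ℝ)
    (h : (-(Matrix.fromBlocks (P' + Aᵀ * P + P * A) (P * G) (Gᵀ * P) (-R))).PosDef)
    (z : Fin n → ℝ) (w : Fin r → ℝ) (f : Fin n → ℝ) (hf : f = A *ᵥ z + G *ᵥ w) :
    f ⬝ᵥ (P *ᵥ z) + z ⬝ᵥ (P' *ᵥ z + P *ᵥ f) ≤ w ⬝ᵥ (R *ᵥ w) := by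
  have h1 := h.posSemidef.dotProduct_mulVec_nonneg (Sum.elim z w)
  have h2 : (A *ᵥ z) ⬝ᵥ (P *ᵥ z) = z ⬝ᵥ (Aᵀ *ᵥ (P *ᵥ z)) := by
    rw [dotProduct_mulVec z, vecMul_transpose]
  have h3 : (G *ᵥ w) ⬝ᵥ (P *ᵥ z) = w ⬝ᵥ (Gᵀ *ᵥ (P *ᵥ z)) := by
    rw [dotProduct_mulVec w, vecMul_transpose]
  subst hf
  simp only [star_trivial, neg_mulVec, dotProduct_neg, fromBlocks_mulVec,
    sumElim_dotProduct_sumElim, add_mulVec, Sum.elim_comp_inl, Sum.elim_comp_inr,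
    dotProduct_add, add_dotProduct, mulVec_add, ← mulVec_mulVec] at h1 h2 h3 ⊢
  linarith

/-- **Sufficiency of the DLMI/LMI condition for IO-FTS w.r.t. W₂ inputs.**
If there is a continuously differentiable symmetric positive definite `P(·)` such that on
`Ω = [t₀, t₀+T]` the block matrix
`[[Ṗ + AᵀP + PA, PG], [GᵀP, −R]]` is negative definite and `P − CᵀQC` is positive definite,
then the system `ẋ = A x + G w`, `x(t₀) = 0`, `y = C x` is IO-FTS w.r.t. `(W₂, Q(·), Ω)`. -/
theorem io_fts_of_dlmi
    {n r m : ℕ} (t₀ T : ℝ) (hT : 0 < T)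
    (A : ℝ → Matrix (Fin n) (Fin n) ℝ)
    (G : ℝ → Matrix (Fin n) (Fin r) ℝ)
    (C : ℝ → Matrix (Fin m) (Fin n) ℝ)
    (R : ℝ → Matrix (Fin r) (Fin r) ℝ)
    (Q : ℝ → Matrix (Fin m) (Fin m) ℝ)
    (hA : ∀ i j, ContinuousOn (fun t => A t i j) (Icc t₀ (t₀ + T)))
    (hG : ∀ i j, ContinuousOn (fun t => G t i j) (Icc t₀ (t₀ + T)))
    (hC : ∀ i j, ContinuousOn (fun t => C t i j) (Icc t₀ (t₀ + T)))
    (hR : ∀ i j, ContinuousOn (fun t => R t i j) (Icc t₀ (t₀ + T)))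
    (hQ : ∀ i j, ContinuousOn (fun t => Q t i j) (Icc t₀ (t₀ + T)))
    (hRpd : ∀ t ∈ Icc t₀ (t₀ + T), (R t).PosDef)
    (hQpd : ∀ t ∈ Icc t₀ (t₀ + T), (Q t).PosDef)
    -- `P` continuously differentiable (with derivative `P'`), symmetric positive definite
    (P P' : ℝ → Matrix (Fin n) (Fin n) ℝ)
    (hPpd : ∀ t ∈ Icc t₀ (t₀ + T), (P t).PosDef)
    (hP'cont : ∀ i j, ContinuousOn (fun t => P' t i j) (Icc t₀ (t₀ + T)))
    (hPderiv : ∀ t ∈ Icc t₀ (t₀ + T), ∀ i j,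
      HasDerivWithinAt (fun s => P s i j) (P' t i j) (Icc t₀ (t₀ + T)) t)
    -- the DLMI: `[[Ṗ + AᵀP + PA, PG], [GᵀP, −R]] < 0` on `Ω`
    (hDLMI : ∀ t ∈ Icc t₀ (t₀ + T),
      (-(Matrix.fromBlocks (P' t + (A t)ᵀ * P t + P t * A t) (P t * G t)
          ((G t)ᵀ * P t) (-(R t)))).PosDef)
    -- the LMI: `P > CᵀQC` on `Ω`
    (hLMI : ∀ t ∈ Icc t₀ (t₀ + T), (P t - (C t)ᵀ * Q t * C t).PosDef) :
    -- IO-FTS with respect to `(W₂, Q(·), Ω)`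
    ∀ w : ℝ → Fin r → ℝ, Measurable w →
      IntervalIntegrable (fun τ => w τ ⬝ᵥ (R τ *ᵥ w τ)) volume t₀ (t₀ + T) →
      (∫ τ in t₀..(t₀ + T), w τ ⬝ᵥ (R τ *ᵥ w τ)) ≤ 1 →
      ∀ x : ℝ → Fin n → ℝ,
        (∀ t ∈ Icc t₀ (t₀ + T),
          IntervalIntegrable (fun τ => A τ *ᵥ x τ + G τ *ᵥ w τ) volume t₀ t ∧
          x t = ∫ τ in t₀..t, (A τ *ᵥ x τ + G τ *ᵥ w τ)) →
        ∀ t ∈ Icc t₀ (t₀ + T), (C t *ᵥ x t) ⬝ᵥ (Q t *ᵥ (C t *ᵥ x t)) < 1 := by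
  intro w hw hwi hw1 x hx t ht
  have hab : t₀ ≤ t₀ + T := by linarith
  set b := t₀ + T with hb
  set F : ℝ → Fin n → ℝ := fun τ => A τ *ᵥ x τ + G τ *ᵥ w τ with hF
  have hFi : ∀ i, IntervalIntegrable (fun τ => F τ i) volume t₀ b := by
    intro i
    have h1 := (hx b ⟨hab, le_rfl⟩).1
    rw [intervalIntegrable_iff] at h1 ⊢
    exact h1.eval i
  have hxz : ∀ τ ∈ Icc t₀ b, ∀ i, x τ i = ∫ s in t₀..τ, F s i := by
    intro τ hτ i
    have h1 := (hx τ hτ)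
    rw [h1.2]
    have h2 := h1.1
    rw [intervalIntegral.integral_of_le hτ.1, intervalIntegral.integral_of_le hτ.1]
    rw [intervalIntegrable_iff_integrableOn_Ioc_of_le hτ.1] at h2
    exact eval_integral (fun i => h2.eval i) i
  let z : ℝ → Fin n → ℝ := fun τ i => ∫ s in t₀..τ, F s i
  have hzx : ∀ τ ∈ Icc t₀ b, z τ = x τ := fun τ hτ => funext fun i => (hxz τ hτ i).symm
  have hzac : ∀ i, AbsolutelyContinuousOnInterval (fun τ => z τ i) t₀ b := fun i =>
    (hFi i).absolutelyContinuousOnInterval_intervalIntegral (by simp)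
  have hPac : ∀ i j, AbsolutelyContinuousOnInterval (fun τ => P τ i j) t₀ b := fun i j =>
    ac_of_deriv t₀ b hab _ _ (hP'cont i j) (fun τ hτ => hPderiv τ hτ i j)
  let V : ℝ → ℝ := fun τ => ∑ i, ∑ j, z τ i * (P τ i j * z τ j)
  have hVac : AbsolutelyContinuousOnInterval V t₀ b :=
    ac_finset_sum _ _ _ _ fun i _ => ac_finset_sum _ _ _ _ fun j _ =>
      (hzac i).fun_mul ((hPac i j).fun_mul (hzac j))
  have hVq : ∀ τ, V τ = z τ ⬝ᵥ (P τ *ᵥ z τ) := by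
    intro τ
    simp only [V, dotProduct, mulVec, Finset.mul_sum]
  have htb : uIcc t₀ t ⊆ uIcc t₀ b := by
    rw [uIcc_of_le ht.1, uIcc_of_le hab]; exact Icc_subset_Icc le_rfl ht.2
  have hVt := hVac.mono htb
  have hV0 : V t₀ = 0 := by simp [V, z]
  have hwR : ∀ τ ∈ Icc t₀ b, 0 ≤ w τ ⬝ᵥ (R τ *ᵥ w τ) := fun τ hτ => by
    simpa using (hRpd τ hτ).posSemidef.dotProduct_mulVec_nonneg (w τ)
  have hder : ∀ᵐ τ, τ ∈ Ioo t₀ b → deriv V τ ≤ w τ ⬝ᵥ (R τ *ᵥ w τ) := by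
    have h1 : ∀ᵐ τ, ∀ i, τ ∈ uIcc t₀ b → HasDerivAt (fun τ => z τ i) (F τ i) τ := by
      rw [ae_all_iff]
      intro i
      filter_upwards [(hFi i).ae_hasDerivAt_integral] with τ h hτ
      exact h hτ t₀ (by simp)
    filter_upwards [h1] with τ h hτ
    have hτ' : τ ∈ Icc t₀ b := Ioo_subset_Icc_self hτ
    have hz : ∀ i, HasDerivAt (fun τ => z τ i) (F τ i) τ := fun i =>
      h i (by rw [uIcc_of_le hab]; exact hτ')
    have hp : ∀ i j, HasDerivAt (fun τ => P τ i j) (P' τ i j) τ := fun i j =>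
      (hPderiv τ hτ' i j).hasDerivAt (Icc_mem_nhds hτ.1 hτ.2)
    have hV : HasDerivAt V (∑ i, ∑ j, (F τ i * (P τ i j * z τ j) +
        z τ i * (P' τ i j * z τ j + P τ i j * F τ j))) τ :=
      HasDerivAt.fun_sum fun i _ => HasDerivAt.fun_sum fun j _ =>
        (hz i).fun_mul ((hp i j).fun_mul (hz j))
    rw [hV.deriv]
    have := dlmi_alg _ _ _ _ _ (hDLMI τ hτ') (z τ) (w τ) (F τ) (by rw [hzx τ hτ'])
    convert this using 1
    simp only [dotProduct, mulVec, Pi.add_apply, Finset.mul_sum, Finset.sum_add_distrib, mul_add]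
  have hwit : IntervalIntegrable (fun τ => w τ ⬝ᵥ (R τ *ᵥ w τ)) volume t₀ t := hwi.mono_set htb
  have hVle : V t ≤ ∫ τ in t₀..t, w τ ⬝ᵥ (R τ *ᵥ w τ) := by
    have := hVt.integral_deriv_eq_sub
    rw [hV0, sub_zero] at this
    rw [← this]
    refine intervalIntegral.integral_mono_ae_restrict ht.1 hVt.intervalIntegrable_deriv hwit ?_
    rw [← restrict_Ioo_eq_restrict_Icc, Filter.EventuallyLE, ae_restrict_iff' measurableSet_Ioo]
    filter_upwards [hder] with τ h hτ
    exact h ⟨hτ.1, hτ.2.trans_le ht.2⟩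
  have hle : (∫ τ in t₀..t, w τ ⬝ᵥ (R τ *ᵥ w τ)) ≤ ∫ τ in t₀..b, w τ ⬝ᵥ (R τ *ᵥ w τ) := by
    refine intervalIntegral.integral_mono_interval le_rfl ht.1 ht.2 ?_ hwi
    rw [Filter.EventuallyLE, ae_restrict_iff' measurableSet_Ioc]
    exact Filter.Eventually.of_forall fun τ hτ => hwR τ (Ioc_subset_Icc_self hτ)
  have hfin : x t ⬝ᵥ (P t *ᵥ x t) ≤ 1 := by
    rw [← hzx t ht, ← hVq]; linarith
  by_cases h0 : x t = 0
  · simp [h0]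
  have h1 := (hLMI t ht).dotProduct_mulVec_pos h0
  have h2 : x t ⬝ᵥ ((C t)ᵀ *ᵥ (Q t *ᵥ (C t *ᵥ x t))) =
      (C t *ᵥ x t) ⬝ᵥ (Q t *ᵥ (C t *ᵥ x t)) := by
    rw [dotProduct_mulVec (x t), vecMul_transpose]
  simp only [star_trivial, sub_mulVec, dotProduct_sub, ← mulVec_mulVec] at h1
  linarith
end

section
/- Consider the linear time-varying system ẋ(t) = A(t)x(t) + G(t)w(t) with x(t₀) = 0 and output y(t) = C(t)x(t) on Ω = [t₀, t₀+T]. If the system is IO-FTS with respect to (W₂, Q(·), Ω), i.e. every input w ∈ W₂ produces an output with y(t)ᵀQ(t)y(t) < 1 for all t ∈ Ω, then there exists a continuously differentiable symmetric positive definite matrix-valued function P : Ω → ℝ^{n×n} such that for every t ∈ Ω the block matrix [[Ṗ(t) + A(t)ᵀP(t) + P(t)A(t), P(t)G(t)], [G(t)ᵀP(t), −R(t)]] is negative definite and P(t) − C(t)ᵀQ(t)C(t) is positive definite. -/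
open MeasureTheory Matrix Set

theorem linODE {E : Type*} [NormedAddCommGroup E] [NormedSpace ℝ E] [FiniteDimensional ℝ E]
    {a b : ℝ} (hab : a ≤ b) (L : ℝ → E →L[ℝ] E) (hL : ContinuousOn L (Icc a b)) (x₀ : E) :
    ∃ x : ℝ → E, x a = x₀ ∧ ∀ t ∈ Icc a b, HasDerivWithinAt x (L t (x t)) (Icc a b) t := by
  have : CompleteSpace E := FiniteDimensional.complete ℝ E
  obtain ⟨K, hK⟩ := isCompact_Icc.exists_bound_of_continuousOn hL
  have hK0 : 0 ≤ K := (norm_nonneg _).trans (hK a ⟨le_rfl, hab⟩)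
  set ρ : ℝ := ‖x₀‖ * Real.exp (K * (b - a)) + 1 with hρ
  have hρ0 : 0 < ρ := by positivity
  let χ : ContDiffBump (0 : E) := ⟨ρ, ρ + 1, hρ0, by linarith⟩
  let g : E → E := fun x => χ x • x
  have hg1 : ∀ x, ‖x‖ ≤ ρ → g x = x := by
    intro x hx
    have : χ x = 1 := χ.one_of_mem_closedBall (by simpa [χ] using hx)
    simp [g, this]
  have hgn : ∀ x, ‖g x‖ ≤ ‖x‖ := by
    intro x
    simp only [g, norm_smul, Real.norm_eq_abs, abs_of_nonneg χ.nonneg]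
    exact mul_le_of_le_one_left (norm_nonneg _) χ.le_one
  have hgb : ∀ x, ‖g x‖ ≤ ρ + 1 := by
    intro x
    by_cases hx : ‖x‖ ≤ ρ + 1
    · exact (hgn x).trans hx
    · have : χ x = 0 := χ.zero_of_le_dist (by simpa [χ] using (not_le.1 hx).le)
      simp [g, this]; positivity
  have hgs : ContDiff ℝ 1 g := χ.contDiff.smul contDiff_id
  have hgc : HasCompactSupport g := χ.hasCompactSupport.smul_right
  obtain ⟨Kg, hKg⟩ := ContDiff.lipschitzWith_of_hasCompactSupport hgc hgs (by simp)
  let Kn : NNReal := ⟨K, hK0⟩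
  let Ln : NNReal := ⟨K * (ρ + 1), by positivity⟩
  let an : NNReal := ⟨K * (ρ + 1) * (b - a), by have := sub_nonneg.2 hab; positivity⟩
  have hPL : IsPicardLindelof (fun t x => L t (g x)) (⟨a, le_rfl, hab⟩ : Icc a b) x₀ an 0 Ln
      (Kn * Kg) := by
    refine ⟨fun t ht => ?_, fun x _ => ?_, fun t ht x _ => ?_, ?_⟩
    · refine LipschitzWith.lipschitzOnWith ?_
      refine LipschitzWith.comp (g := g) ?_ hKg
      refine (L t).lipschitz.weaken ?_
      exact hK t ht
    · exact hL.clm_apply continuousOn_const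
    · exact ((L t).le_opNorm _).trans (mul_le_mul (hK t ht) (hgb x) (norm_nonneg _) hK0)
    · have : max (b - a) (a - a) = b - a := by simp [hab]
      simp only [this, NNReal.coe_zero, sub_zero]
      exact le_rfl
  obtain ⟨x, hx0, hx⟩ := hPL.exists_eq_forall_mem_Icc_hasDerivWithinAt₀
  simp only at hx0
  refine ⟨x, hx0, fun t ht => ?_⟩
  have hc : ContinuousOn x (Icc a b) := fun t ht => (hx t ht).continuousWithinAt
  have key := norm_le_gronwallBound_of_norm_deriv_right_le (δ := ‖x₀‖) (K := K) (ε := 0) hc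
    (fun t ht => ((hx t ⟨ht.1, ht.2.le⟩).mono_of_mem_nhdsWithin
      (Icc_mem_nhdsGE_of_mem ht))) (by rw [hx0])
    (fun t ht => by
      simp only [add_zero]
      exact ((L t).le_opNorm _).trans (mul_le_mul (hK t ⟨ht.1, ht.2.le⟩) (hgn _) (norm_nonneg _) hK0))
    t ht
  rw [gronwallBound_ε0] at key
  have : ‖x t‖ ≤ ρ := by
    refine key.trans ?_
    have : Real.exp (K * (t - a)) ≤ Real.exp (K * (b - a)) := by
      gcongr; exact ht.2
    have := mul_le_mul_of_nonneg_left this (norm_nonneg x₀)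
    linarith
  have h := hx t ht
  rwa [hg1 _ this] at h

open scoped Matrix.Norms.Operator in
theorem fund {n : ℕ} {a b : ℝ} (hab : a ≤ b) (A : ℝ → Matrix (Fin n) (Fin n) ℝ)
    (hA : Continuous A) :
    ∃ Φ Ψ : ℝ → Matrix (Fin n) (Fin n) ℝ, Continuous Φ ∧ Continuous Ψ ∧
      (∀ t ∈ Icc a b, HasDerivWithinAt Φ (A t * Φ t) (Icc a b) t) ∧
      (∀ t ∈ Icc a b, HasDerivWithinAt Ψ (-(Ψ t * A t)) (Icc a b) t) ∧
      (∀ t, Ψ t * Φ t = 1) := by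
  obtain ⟨Φ, hΦ0, hΦ⟩ := linODE hab (fun t => ContinuousLinearMap.mul ℝ _ (A t))
    (by fun_prop) 1
  obtain ⟨Ψ, hΨ0, hΨ⟩ := linODE hab (fun t => -((ContinuousLinearMap.mul ℝ _).flip (A t)))
    (by fun_prop) 1
  simp only [ContinuousLinearMap.mul_apply', _root_.neg_apply,
    ContinuousLinearMap.flip_apply] at hΦ hΨ
  have h1 : ∀ t ∈ Icc a b, Ψ t * Φ t = 1 := by
    intro t ht
    have hd : ∀ s ∈ Icc a b, HasDerivWithinAt (fun s => Ψ s * Φ s) 0 (Icc a b) s := by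
      intro s hs
      have := (hΨ s hs).mul (hΦ s hs)
      convert! this using 1
      noncomm_ring
    have := constant_of_has_deriv_right_zero (f := fun s => Ψ s * Φ s)
      (fun s hs => (hd s hs).continuousWithinAt)
      (fun s hs => ((hd s ⟨hs.1, hs.2.le⟩).mono_of_mem_nhdsWithin (Icc_mem_nhdsGE_of_mem hs)))
      t ht
    rw [this, hΦ0, hΨ0, mul_one]
  let π : ℝ → ℝ := fun t => projIcc a b hab t
  have hπ : Continuous π := by fun_prop
  have hπm : ∀ t, π t ∈ Icc a b := fun t => (projIcc a b hab t).2
  have hπe : ∀ t ∈ Icc a b, π t = t := fun t ht => by simp [π, projIcc_of_mem hab ht]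
  refine ⟨Φ ∘ π, Ψ ∘ π, ?_, ?_, ?_, ?_, fun t => h1 _ (hπm t)⟩
  · exact ContinuousOn.comp_continuous (fun t ht => (hΦ t ht).continuousWithinAt) hπ hπm
  · exact ContinuousOn.comp_continuous (fun t ht => (hΨ t ht).continuousWithinAt) hπ hπm
  · intro t ht
    simp only [Function.comp, hπe t ht]
    exact (hΦ t ht).congr (fun s hs => by simp [hπe s hs]) (by simp [hπe t ht])
  · intro t ht
    simp only [Function.comp, hπe t ht]
    exact (hΨ t ht).congr (fun s hs => by simp [hπe s hs]) (by simp [hπe t ht])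

theorem psd_cs {k : ℕ} {M : Matrix (Fin k) (Fin k) ℝ} (hM : M.PosSemidef) (x y : Fin k → ℝ) :
    (x ⬝ᵥ (M *ᵥ y)) ^ 2 ≤ (x ⬝ᵥ (M *ᵥ x)) * (y ⬝ᵥ (M *ᵥ y)) := by
  have hT : Mᵀ = M := by simpa using hM.1.eq
  have hs : y ⬝ᵥ (M *ᵥ x) = x ⬝ᵥ (M *ᵥ y) := by
    rw [dotProduct_mulVec, ← mulVec_transpose, hT, dotProduct_comm]
  have h : ∀ s : ℝ, 0 ≤ (y ⬝ᵥ (M *ᵥ y)) * (s * s) + (2 * (x ⬝ᵥ (M *ᵥ y))) * s + x ⬝ᵥ (M *ᵥ x) := by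
    intro s
    have := hM.dotProduct_mulVec_nonneg (x + s • y)
    simp only [star_trivial, mulVec_add, mulVec_smul, dotProduct_add, add_dotProduct,
      smul_dotProduct, dotProduct_smul, smul_eq_mul, hs] at this
    linarith
  have := discrim_le_zero h
  unfold discrim at this
  nlinarith

theorem final_pd {n m : ℕ} {W P : Matrix (Fin n) (Fin n) ℝ} {Q : Matrix (Fin m) (Fin m) ℝ}
    (C : Matrix (Fin m) (Fin n) ℝ) (hW : W.PosSemidef) (hP : P.PosDef) (hWP : W * P = 1)
    (hQ : Q.PosDef)
    (h : ∀ y : Fin m → ℝ, y ≠ 0 →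
      (Cᵀ *ᵥ (Q *ᵥ y)) ⬝ᵥ (W *ᵥ (Cᵀ *ᵥ (Q *ᵥ y))) < y ⬝ᵥ (Q *ᵥ y)) :
    (P - Cᵀ * Q * C).PosDef := by
  have hPT : Pᵀ = P := by simpa using hP.1.eq
  have hQT : Qᵀ = Q := by simpa using hQ.1.eq
  refine .of_dotProduct_mulVec_pos ?_ fun x hx => ?_
  · refine hP.1.sub ?_
    simp [IsHermitian, conjTranspose_eq_transpose_of_trivial, transpose_mul, hQT, Matrix.mul_assoc]
  have hpos : 0 < x ⬝ᵥ (P *ᵥ x) := by simpa using hP.dotProduct_mulVec_pos hx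
  have e1 : x ⬝ᵥ ((Cᵀ * Q * C) *ᵥ x) = (C *ᵥ x) ⬝ᵥ (Q *ᵥ (C *ᵥ x)) := by
    rw [← mulVec_mulVec, ← mulVec_mulVec, dotProduct_mulVec, vecMul_transpose]
  rw [star_trivial, sub_mulVec, dotProduct_sub, e1, sub_pos]
  by_cases hy : C *ᵥ x = 0
  · simpa [hy] using hpos
  set y := C *ᵥ x with hydef
  have hxw : W *ᵥ (P *ᵥ x) = x := by rw [mulVec_mulVec, hWP, one_mulVec]
  have cs := psd_cs hW (Cᵀ *ᵥ (Q *ᵥ y)) (P *ᵥ x)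
  rw [hxw] at cs
  have e2 : (Cᵀ *ᵥ (Q *ᵥ y)) ⬝ᵥ x = y ⬝ᵥ (Q *ᵥ y) := by
    rw [mulVec_transpose, ← dotProduct_mulVec, dotProduct_comm]
  rw [e2, dotProduct_comm (P *ᵥ x) x] at cs
  have hh := h y hy
  have hq : 0 < y ⬝ᵥ (Q *ᵥ y) := by simpa using hQ.dotProduct_mulVec_pos hy
  have := mul_lt_mul_of_pos_right hh hpos
  nlinarith

theorem block_pd {n r : ℕ} {P : Matrix (Fin n) (Fin n) ℝ} {R : Matrix (Fin r) (Fin r) ℝ}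
    (G : Matrix (Fin n) (Fin r) ℝ) (hP : P.PosDef) (hR : R.PosDef) {ε : ℝ} (hε : 0 < ε)
    {X : Matrix (Fin n) (Fin n) ℝ} (hX : X = -(P * G * R⁻¹ * Gᵀ * P) - ε • (P * P)) :
    (-(fromBlocks X (P * G) (Gᵀ * P) (-R))).PosDef := by
  have hPT : Pᵀ = P := by simpa using hP.1.eq
  have hRT : Rᵀ = R := by simpa using hR.1.eq
  have : Invertible R := hR.isUnit.invertible
  have hPP : (P * P).PosDef := by
    have := hP.isUnit
    have h2 := (PosDef.one (n := Fin n) (R := ℝ)).conjTranspose_mul_mul_same (B := P)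
      (mulVec_injective_of_isUnit this)
    simpa [conjTranspose_eq_transpose_of_trivial, hPT] using h2
  have hB : (-(P * G))ᴴ = -(Gᵀ * P) := by
    simp [conjTranspose_eq_transpose_of_trivial, transpose_mul, hPT]
  have hXe : -X - -(P * G) * R⁻¹ * (-(P * G))ᴴ = ε • (P * P) := by
    rw [hB, hX]; simp [Matrix.mul_assoc]
  have hXT : (-X).IsHermitian := by
    have : -X = P * G * R⁻¹ * Gᵀ * P + ε • (P * P) := by rw [hX]; abel
    rw [this]
    simp [IsHermitian, conjTranspose_eq_transpose_of_trivial, transpose_mul, hPT,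
      transpose_nonsing_inv, hRT, Matrix.mul_assoc]
  rw [fromBlocks_neg, neg_neg, ← hB]
  refine .of_dotProduct_mulVec_pos ?_ fun z hz => ?_
  · exact IsHermitian.fromBlocks hXT rfl hR.1
  · rw [dotProduct_mulVec, ← Sum.elim_comp_inl_inr z, schur_complement_eq₂₂ _ _ _ _ hR.1, hXe]
    rw [← dotProduct_mulVec, ← dotProduct_mulVec]
    have a1 := hR.posSemidef.dotProduct_mulVec_nonneg ((R⁻¹ * (-(P * G))ᴴ) *ᵥ (z ∘ Sum.inl) + z ∘ Sum.inr)
    by_cases hzl : z ∘ Sum.inl = 0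
    · have hzr : z ∘ Sum.inr ≠ 0 := by
        intro h; apply hz
        rw [← Sum.elim_comp_inl_inr z, hzl, h]; ext (i | i) <;> rfl
      have := hR.dotProduct_mulVec_pos hzr
      simpa [hzl] using this
    · have a2 := (hPP.smul hε).dotProduct_mulVec_pos hzl
      linarith

open scoped Matrix.Norms.Operator in
theorem quad_integral {n : ℕ} {F : ℝ → Matrix (Fin n) (Fin n) ℝ} (hF : Continuous F)
    (a b : ℝ) (x y : Fin n → ℝ) :
    x ⬝ᵥ ((∫ τ in a..b, F τ) *ᵥ y) = ∫ τ in a..b, x ⬝ᵥ (F τ *ᵥ y) := by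
  let l : Matrix (Fin n) (Fin n) ℝ →ₗ[ℝ] ℝ :=
    { toFun := fun M => x ⬝ᵥ (M *ᵥ y)
      map_add' := by intro M N; simp [add_mulVec, dotProduct_add]
      map_smul' := by intro c M; simp [smul_mulVec, dotProduct_smul] }
  exact (l.toContinuousLinearMap.intervalIntegral_comp_comm (hF.intervalIntegrable a b)).symm

open scoped Matrix.Norms.Operator in
theorem int_psd {n : ℕ} {F : ℝ → Matrix (Fin n) (Fin n) ℝ} (hF : Continuous F)
    (hp : ∀ t, (F t).PosSemidef) {a b : ℝ} (hab : a ≤ b) :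
    (∫ τ in a..b, F τ).PosSemidef := by
  refine .of_dotProduct_mulVec_nonneg ?_ fun x => ?_
  · ext i j
    have hij := quad_integral hF a b (Pi.single i 1) (Pi.single j 1)
    have hji := quad_integral hF a b (Pi.single j 1) (Pi.single i 1)
    simp only [mulVec_single_one, single_one_dotProduct, col_apply] at hij hji
    rw [conjTranspose_apply, star_trivial, hij, hji]
    congr 1; ext τ
    simpa using (hp τ).1.apply i j
  · rw [star_trivial, quad_integral hF]
    exact intervalIntegral.integral_nonneg hab fun t _ => by
      simpa using (hp t).dotProduct_mulVec_nonneg x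

open scoped Matrix.Norms.Operator in
theorem gain {n r m : ℕ} (t₀ T : ℝ)
    (A : ℝ → Matrix (Fin n) (Fin n) ℝ)
    (G : ℝ → Matrix (Fin n) (Fin r) ℝ)
    (C : ℝ → Matrix (Fin m) (Fin n) ℝ)
    (R : ℝ → Matrix (Fin r) (Fin r) ℝ)
    (Q : ℝ → Matrix (Fin m) (Fin m) ℝ)
    (hA : Continuous A) (hG : Continuous G) (hR : Continuous R)
    (hRi : Continuous fun t => (R t)⁻¹)
    (hRpd : ∀ t, (R t).PosDef)
    (hQpd : ∀ t, (Q t).PosDef)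
    (hIOFTS : ∀ w : ℝ → Fin r → ℝ, Measurable w →
      IntervalIntegrable (fun τ => w τ ⬝ᵥ (R τ *ᵥ w τ)) volume t₀ (t₀ + T) →
      (∫ τ in t₀..(t₀ + T), w τ ⬝ᵥ (R τ *ᵥ w τ)) ≤ 1 →
      ∀ x : ℝ → Fin n → ℝ,
        (∀ t ∈ Icc t₀ (t₀ + T),
          IntervalIntegrable (fun τ => A τ *ᵥ x τ + G τ *ᵥ w τ) volume t₀ t ∧
          x t = ∫ τ in t₀..t, (A τ *ᵥ x τ + G τ *ᵥ w τ)) →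
        ∀ t ∈ Icc t₀ (t₀ + T), (C t *ᵥ x t) ⬝ᵥ (Q t *ᵥ (C t *ᵥ x t)) < 1)
    (Φ Ψ : ℝ → Matrix (Fin n) (Fin n) ℝ) (hΦc : Continuous Φ) (hΨc : Continuous Ψ)
    (hΦ : ∀ t ∈ Icc t₀ (t₀ + T), HasDerivWithinAt Φ (A t * Φ t) (Icc t₀ (t₀ + T)) t)
    (hΨΦ : ∀ t, Ψ t * Φ t = 1)
    (F : ℝ → Matrix (Fin n) (Fin n) ℝ)
    (hF : ∀ t, F t = Ψ t * G t * (R t)⁻¹ * (G t)ᵀ * (Ψ t)ᵀ)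
    (hFc : Continuous F)
    (t₁ : ℝ) (ht₁ : t₁ ∈ Icc t₀ (t₀ + T)) (y : Fin m → ℝ) (hy : y ≠ 0) :
    ((C t₁)ᵀ *ᵥ (Q t₁ *ᵥ y)) ⬝ᵥ ((Φ t₁ * (∫ τ in t₀..t₁, F τ) * (Φ t₁)ᵀ) *ᵥ
      ((C t₁)ᵀ *ᵥ (Q t₁ *ᵥ y))) < y ⬝ᵥ (Q t₁ *ᵥ y) := by
  by_contra hcon
  rw [not_lt] at hcon
  have hq0 : 0 < y ⬝ᵥ (Q t₁ *ᵥ y) := by simpa using (hQpd t₁).dotProduct_mulVec_pos hy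
  set u : Fin n → ℝ := (C t₁)ᵀ *ᵥ (Q t₁ *ᵥ y) with hu
  set M : ℝ → Matrix (Fin n) (Fin n) ℝ := fun t => ∫ τ in t₀..t, F τ with hM
  set s : ℝ := u ⬝ᵥ ((Φ t₁ * M t₁ * (Φ t₁)ᵀ) *ᵥ u) with hs
  have hs0 : 0 < s := hq0.trans_le hcon
  set q : Fin n → ℝ := (Φ t₁)ᵀ *ᵥ u with hq
  have hsq : s = q ⬝ᵥ (M t₁ *ᵥ q) := by
    rw [hs, hq, ← mulVec_mulVec, ← mulVec_mulVec, dotProduct_mulVec, ← mulVec_transpose]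
  obtain ⟨c, hc⟩ : ∃ c : ℝ, c * c * s = 1 := by
    refine ⟨(Real.sqrt s)⁻¹, ?_⟩
    have := Real.mul_self_sqrt hs0.le
    have h2 : Real.sqrt s ≠ 0 := (Real.sqrt_pos.2 hs0).ne'
    field_simp
    nlinarith
  have hMd : ∀ t, HasDerivAt M (F t) t := fun t =>
    (hFc.integral_hasStrictDerivAt t₀ t).hasDerivAt
  have hMc : Continuous M := continuous_iff_continuousAt.2 fun t => (hMd t).continuousAt
  let v : ℝ → Fin r → ℝ := fun τ => c • (((R τ)⁻¹ * (G τ)ᵀ * (Ψ τ)ᵀ) *ᵥ q)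
  have hvc : Continuous v := by fun_prop
  let w : ℝ → Fin r → ℝ := fun τ => indicator {τ | τ ≤ t₁} v τ
  have hwm : Measurable w := hvc.measurable.indicator measurableSet_Iic
  have hRu : ∀ τ, IsUnit (R τ).det := fun τ => (isUnit_iff_isUnit_det _).1 (hRpd τ).isUnit
  have hRT : ∀ τ, (R τ)ᵀ = R τ := fun τ => by simpa using (hRpd τ).1.eq
  have hvR : ∀ τ, v τ ⬝ᵥ (R τ *ᵥ v τ) = c * c * (q ⬝ᵥ (F τ *ᵥ q)) := by
    intro τ
    simp only [v, mulVec_smul, dotProduct_smul, smul_dotProduct, smul_eq_mul, ← mul_assoc]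
    congr 1
    rw [dotProduct_comm, dotProduct_mulVec, ← mulVec_transpose, dotProduct_comm, mulVec_mulVec,
      mulVec_mulVec, hF]
    congr 2
    simp only [transpose_mul, transpose_transpose, transpose_nonsing_inv, hRT, Matrix.mul_assoc]
    rw [mul_nonsing_inv_cancel_left _ _ (hRu τ)]
  have hwR : (fun τ => w τ ⬝ᵥ (R τ *ᵥ w τ)) =
      indicator {τ | τ ≤ t₁} (fun τ => v τ ⬝ᵥ (R τ *ᵥ v τ)) := by
    ext τ
    by_cases h : τ ≤ t₁ <;> simp [w, indicator, h]
  have hcont1 : Continuous (fun τ => v τ ⬝ᵥ (R τ *ᵥ v τ)) := by fun_prop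
  have hint : ∀ {k : ℕ} (f : ℝ → Fin k → ℝ), Continuous f → ∀ a b, IntervalIntegrable
      (indicator {τ | τ ≤ t₁} f) volume a b := by
    intro k f hf a b
    have := hf.intervalIntegrable (μ := volume) a b
    exact ⟨this.1.indicator measurableSet_Iic, this.2.indicator measurableSet_Iic⟩
  have hGw : (fun τ => G τ *ᵥ w τ) = indicator {τ | τ ≤ t₁} (fun τ => G τ *ᵥ v τ) := by
    ext τ
    by_cases h : τ ≤ t₁ <;> simp [w, indicator, h]
  let e : Matrix (Fin n) (Fin n) ℝ →L[ℝ] (Fin n → ℝ) := LinearMap.toContinuousLinearMap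
    { toFun := fun M => M *ᵥ (c • q)
      map_add' := by intro M N; simp only [add_mulVec]
      map_smul' := by intro c M; simp only [smul_mulVec, RingHom.id_apply] }
  have he : ∀ N, e N = N *ᵥ (c • q) := fun N => rfl
  let x : ℝ → Fin n → ℝ := fun t => (Φ t * M (min t t₁)) *ᵥ (c • q)
  have hxc : Continuous x := by fun_prop
  have hΦF : ∀ t, (Φ t * F t) *ᵥ (c • q) = G t *ᵥ v t := by
    intro t
    have h1 : Φ t * Ψ t = 1 := mul_eq_one_comm.1 (hΨΦ t)
    simp only [v, hF, mulVec_smul, mulVec_mulVec]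
    simp only [← Matrix.mul_assoc]
    rw [h1, Matrix.one_mul]
  have hAx : ∀ a b, IntervalIntegrable (fun τ => A τ *ᵥ x τ) volume a b := fun a b =>
    Continuous.intervalIntegrable (by fun_prop) a b
  have hmain := hIOFTS w hwm
    (by
      rw [hwR]
      have := hcont1.intervalIntegrable (μ := volume) t₀ (t₀ + T)
      exact ⟨this.1.indicator measurableSet_Iic, this.2.indicator measurableSet_Iic⟩)
    (by
      rw [hwR, intervalIntegral.integral_indicator ht₁]
      simp only [hvR]
      rw [intervalIntegral.integral_const_mul, ← quad_integral hFc, ← hsq, hc])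
    x
    (by
      intro t ht
      have hI : IntervalIntegrable (fun τ => A τ *ᵥ x τ + G τ *ᵥ w τ) volume t₀ t := by
        refine (hAx _ _).add ?_
        rw [hGw]
        exact hint _ (by fun_prop) _ _
      refine ⟨hI, ?_⟩
      have := integral_eq_of_hasDerivAt_off_countable_of_le x _ ht.1 (countable_singleton t₁)
        hxc.continuousOn ?_ hI
      · rw [this]
        have : x t₀ = 0 := by simp [x, min_eq_left ht₁.1, M]
        rw [this, sub_zero]
      · rintro z ⟨hz, hzt⟩
        have hzI : z ∈ Icc t₀ (t₀ + T) := ⟨hz.1.le, hz.2.le.trans ht.2⟩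
        have hΦz : HasDerivAt Φ (A z * Φ z) z := (hΦ z hzI).hasDerivAt
          (Icc_mem_nhds hz.1 (hz.2.trans_le ht.2))
        rcases lt_or_gt_of_ne hzt with h | h
        · have h1 := e.hasFDerivAt.comp_hasDerivAt z (hΦz.mul (hMd z))
          have h2 : x =ᶠ[nhds z] (e ∘ (Φ * M)) := by
            filter_upwards [Iio_mem_nhds h] with t' ht'
            simp [x, he, min_eq_left (mem_Iio.1 ht').le]
          refine (h1.congr_of_eventuallyEq h2).congr_deriv ?_
          change (A z * Φ z * M z + Φ z * F z) *ᵥ (c • q) = _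
          rw [add_mulVec, hΦF]
          simp only [x, w, indicator, mem_ofPred_eq, h.le, if_true, min_eq_left, mulVec_mulVec,
            Matrix.mul_assoc]
        · have h1 := e.hasFDerivAt.comp_hasDerivAt z (hΦz.mul (hasDerivAt_const z (M t₁)))
          have h2 : x =ᶠ[nhds z] (e ∘ (Φ * fun _ => M t₁)) := by
            filter_upwards [Ioi_mem_nhds h] with t' ht'
            simp [x, he, min_eq_right (mem_Ioi.1 ht').le]
          refine (h1.congr_of_eventuallyEq h2).congr_deriv ?_
          have h' : ¬ z ≤ t₁ := not_le.2 h
          change (A z * Φ z * M t₁ + Φ z * 0) *ᵥ (c • q) = _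
          simp only [x, w, indicator, mem_ofPred_eq, h', if_false, min_eq_right h.le, mulVec_mulVec,
            Matrix.mul_assoc, mulVec_zero, mul_zero, add_zero])
    t₁ ht₁
  set z : Fin m → ℝ := C t₁ *ᵥ ((Φ t₁ * M t₁) *ᵥ q) with hz
  have hx1 : C t₁ *ᵥ x t₁ = c • z := by
    simp only [x, min_self, mulVec_smul, hz]
  rw [hx1] at hmain
  simp only [mulVec_smul, dotProduct_smul, smul_dotProduct, smul_eq_mul, ← mul_assoc] at hmain
  have hzy : y ⬝ᵥ (Q t₁ *ᵥ z) = s := by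
    have hQT : (Q t₁)ᵀ = Q t₁ := by simpa using (hQpd t₁).1.eq
    rw [hs, hu, hz, hq, dotProduct_mulVec, ← mulVec_transpose, hQT, dotProduct_mulVec,
      ← mulVec_transpose]
    simp only [u, mulVec_mulVec, Matrix.mul_assoc]
  have cs := psd_cs (hQpd t₁).posSemidef y z
  rw [hzy] at cs
  have h3 : z ⬝ᵥ (Q t₁ *ᵥ z) < s := by
    have hcc : 0 < c * c := by
      by_contra h
      nlinarith [mul_self_nonneg c]
    by_contra h
    have := mul_le_mul_of_nonneg_left (not_lt.1 h) hcc.le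
    linarith
  have h4 := mul_lt_mul_of_pos_left h3 hq0
  have h5 := mul_le_mul_of_nonneg_right hcon hs0.le
  nlinarith

theorem exists_eps {X : Type*} [TopologicalSpace X] {K : Set X} (hK : IsCompact K)
    {f g : X → ℝ} (hf : ContinuousOn f K) (hg : ContinuousOn g K) (h : ∀ p ∈ K, 0 < f p) :
    ∃ ε > 0, ∀ p ∈ K, ε * g p < f p := by
  rcases K.eq_empty_or_nonempty with h0 | hne
  · exact ⟨1, one_pos, by simp [h0]⟩
  have hpos : ∀ p, 0 < |g p| + 1 := fun p => by positivity
  obtain ⟨p, hp, hmin⟩ := hK.exists_isMinOn hne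
    (hf.div (hg.abs.add continuousOn_const) (fun p _ => (hpos p).ne'))
  refine ⟨f p / (|g p| + 1), div_pos (h p hp) (hpos p), fun p' hp' => ?_⟩
  have h1 : f p / (|g p| + 1) ≤ f p' / (|g p'| + 1) := hmin hp'
  have h2 : 0 < f p / (|g p| + 1) := div_pos (h p hp) (hpos p)
  rw [le_div_iff₀ (hpos p')] at h1
  have := le_abs_self (g p')
  nlinarith

theorem cont_inv {r : ℕ} {R : ℝ → Matrix (Fin r) (Fin r) ℝ} (hR : Continuous R)
    (hRpd : ∀ t, (R t).PosDef) : Continuous fun t => (R t)⁻¹ := by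
  simp only [Matrix.inv_def, Ring.inverse_eq_inv']
  exact (hR.matrix_det.inv₀ fun t => (hRpd t).det_pos.ne').smul hR.matrix_adjugate

open scoped Matrix.Norms.Operator in
theorem inv_deriv {n : ℕ} {N : ℝ → Matrix (Fin n) (Fin n) ℝ} {N' : Matrix (Fin n) (Fin n) ℝ}
    {t : ℝ} (h : HasDerivAt N N' t) (hu : IsUnit (N t)) :
    HasDerivAt (fun s => (N s)⁻¹) (-((N t)⁻¹ * N' * (N t)⁻¹)) t := by
  obtain ⟨U, hU⟩ := hu
  have h1 := hasFDerivAt_ringInverse (𝕜 := ℝ) U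
  rw [hU] at h1
  have h2 := h1.comp_hasDerivAt t h
  have h3 : ((U⁻¹ : (Matrix (Fin n) (Fin n) ℝ)ˣ) : Matrix (Fin n) (Fin n) ℝ) = (N t)⁻¹ := by
    rw [← hU, Matrix.coe_units_inv]
  have h4 : (fun s => (N s)⁻¹) = Ring.inverse ∘ N := by
    ext1 s; simp [Matrix.nonsing_inv_eq_ringInverse]
  rw [h4]
  refine h2.congr_deriv ?_
  rw [← h3]
  rfl

open scoped Matrix.Norms.Operator in
theorem transpose_deriv {n : ℕ} {N : ℝ → Matrix (Fin n) (Fin n) ℝ} {N' : Matrix (Fin n) (Fin n) ℝ}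
    {t : ℝ} {s : Set ℝ} (h : HasDerivWithinAt N N' s t) :
    HasDerivWithinAt (fun s => (N s)ᵀ) (N'ᵀ) s t := by
  let e : Matrix (Fin n) (Fin n) ℝ →L[ℝ] Matrix (Fin n) (Fin n) ℝ := LinearMap.toContinuousLinearMap
    { toFun := fun M => Mᵀ
      map_add' := by intro M N; simp only [transpose_add]
      map_smul' := by intro c M; simp only [transpose_smul, RingHom.id_apply] }
  exact e.hasFDerivAt.comp_hasDerivWithinAt t h

open scoped Matrix.Norms.Operator in
theorem entry_deriv {n : ℕ} {N : ℝ → Matrix (Fin n) (Fin n) ℝ} {N' : Matrix (Fin n) (Fin n) ℝ}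
    {t : ℝ} {s : Set ℝ} (h : HasDerivWithinAt N N' s t) (i j : Fin n) :
    HasDerivWithinAt (fun s => N s i j) (N' i j) s t := by
  let e : Matrix (Fin n) (Fin n) ℝ →L[ℝ] ℝ := LinearMap.toContinuousLinearMap
    (Matrix.entryLinearMap ℝ ℝ i j)
  exact e.hasFDerivAt.comp_hasDerivWithinAt t h

open scoped Matrix.Norms.Operator in
theorem core {n r m : ℕ} (t₀ T : ℝ) (hT : 0 < T)
    (A : ℝ → Matrix (Fin n) (Fin n) ℝ)
    (G : ℝ → Matrix (Fin n) (Fin r) ℝ)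
    (C : ℝ → Matrix (Fin m) (Fin n) ℝ)
    (R : ℝ → Matrix (Fin r) (Fin r) ℝ)
    (Q : ℝ → Matrix (Fin m) (Fin m) ℝ)
    (hA : Continuous A) (hG : Continuous G) (hC : Continuous C) (hR : Continuous R)
    (hQ : Continuous Q)
    (hRpd : ∀ t, (R t).PosDef)
    (hQpd : ∀ t, (Q t).PosDef)
    (hIOFTS : ∀ w : ℝ → Fin r → ℝ, Measurable w →
      IntervalIntegrable (fun τ => w τ ⬝ᵥ (R τ *ᵥ w τ)) volume t₀ (t₀ + T) →
      (∫ τ in t₀..(t₀ + T), w τ ⬝ᵥ (R τ *ᵥ w τ)) ≤ 1 →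
      ∀ x : ℝ → Fin n → ℝ,
        (∀ t ∈ Icc t₀ (t₀ + T),
          IntervalIntegrable (fun τ => A τ *ᵥ x τ + G τ *ᵥ w τ) volume t₀ t ∧
          x t = ∫ τ in t₀..t, (A τ *ᵥ x τ + G τ *ᵥ w τ)) →
        ∀ t ∈ Icc t₀ (t₀ + T), (C t *ᵥ x t) ⬝ᵥ (Q t *ᵥ (C t *ᵥ x t)) < 1) :
    ∃ P P' : ℝ → Matrix (Fin n) (Fin n) ℝ,
      (∀ t ∈ Icc t₀ (t₀ + T), (P t).PosDef) ∧
      (∀ i j, ContinuousOn (fun t => P' t i j) (Icc t₀ (t₀ + T))) ∧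
      (∀ t ∈ Icc t₀ (t₀ + T), ∀ i j,
        HasDerivWithinAt (fun s => P s i j) (P' t i j) (Icc t₀ (t₀ + T)) t) ∧
      (∀ t ∈ Icc t₀ (t₀ + T),
        (-(Matrix.fromBlocks (P' t + (A t)ᵀ * P t + P t * A t) (P t * G t)
            ((G t)ᵀ * P t) (-(R t)))).PosDef) ∧
      (∀ t ∈ Icc t₀ (t₀ + T), (P t - (C t)ᵀ * Q t * C t).PosDef) := by
  have hRi := cont_inv hR hRpd
  obtain ⟨Φ, Ψ, hΦc, hΨc, hΦ, hΨ, hΨΦ⟩ := fund (by linarith : t₀ ≤ t₀ + T) A hA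
  have hΦΨ : ∀ t, Φ t * Ψ t = 1 := fun t => mul_eq_one_comm.1 (hΨΦ t)
  set F : ℝ → Matrix (Fin n) (Fin n) ℝ :=
    fun t => Ψ t * G t * (R t)⁻¹ * (G t)ᵀ * (Ψ t)ᵀ with hF
  have hFc : Continuous F := by fun_prop
  have hFp : ∀ t, (F t).PosSemidef := by
    intro t
    have := (hRpd t).inv.posSemidef.mul_mul_conjTranspose_same (Ψ t * G t)
    simpa [hF, conjTranspose_eq_transpose_of_trivial, transpose_mul, Matrix.mul_assoc] using this
  set H : ℝ → Matrix (Fin n) (Fin n) ℝ := fun t => Ψ t * (Ψ t)ᵀ with hH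
  have hHc : Continuous H := by fun_prop
  have hHp : ∀ t, (H t).PosSemidef := by
    intro t
    have := posSemidef_self_mul_conjTranspose (Ψ t)
    simpa [hH, conjTranspose_eq_transpose_of_trivial] using this
  set M : ℝ → Matrix (Fin n) (Fin n) ℝ := fun t => ∫ τ in t₀..t, F τ with hM
  set D : ℝ → Matrix (Fin n) (Fin n) ℝ := fun t => ∫ τ in t₀..t, H τ with hD
  have hMd : ∀ t, HasDerivAt M (F t) t := fun t => (hFc.integral_hasStrictDerivAt t₀ t).hasDerivAt
  have hMc : Continuous M := continuous_iff_continuousAt.2 fun t => (hMd t).continuousAt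
  have hDd : ∀ t, HasDerivAt D (H t) t := fun t => (hHc.integral_hasStrictDerivAt t₀ t).hasDerivAt
  have hDc : Continuous D := continuous_iff_continuousAt.2 fun t => (hDd t).continuousAt
  let u : ℝ × (Fin m → ℝ) → Fin n → ℝ := fun p => (C p.1)ᵀ *ᵥ (Q p.1 *ᵥ p.2)
  have huc : Continuous u := by fun_prop
  let f : ℝ × (Fin m → ℝ) → ℝ := fun p => p.2 ⬝ᵥ (Q p.1 *ᵥ p.2) -
    u p ⬝ᵥ ((Φ p.1 * M p.1 * (Φ p.1)ᵀ) *ᵥ u p)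
  let g : ℝ × (Fin m → ℝ) → ℝ := fun p =>
    u p ⬝ᵥ ((Φ p.1 * (1 + D p.1) * (Φ p.1)ᵀ) *ᵥ u p)
  have hfc : Continuous f := by fun_prop
  have hgc : Continuous g := by fun_prop
  have hgain := gain t₀ T A G C R Q hA hG hR hRi hRpd hQpd hIOFTS Φ Ψ hΦc hΨc hΦ hΨΦ F
    (fun t => rfl) hFc
  obtain ⟨ε, hε, hεK⟩ := exists_eps (K := Icc t₀ (t₀ + T) ×ˢ Metric.sphere (0 : Fin m → ℝ) 1)
    (isCompact_Icc.prod (isCompact_sphere _ _)) hfc.continuousOn hgc.continuousOn (by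
      rintro ⟨t, y⟩ ⟨ht, hy⟩
      have hy0 : y ≠ 0 := by
        rintro rfl
        simp at hy
      exact sub_pos.2 (hgain t ht y hy0))
  set N : ℝ → Matrix (Fin n) (Fin n) ℝ := fun t => M t + ε • (1 + D t) with hN
  have hNd : ∀ t, HasDerivAt N (F t + ε • H t) t := fun t =>
    (hMd t).add (((hDd t).const_add 1).const_smul ε)
  have hNp : ∀ t ∈ Icc t₀ (t₀ + T), (N t).PosDef := by
    intro t ht
    have h1 : (M t).PosSemidef := int_psd hFc hFp ht.1
    have h2 : (D t).PosSemidef := int_psd hHc hHp ht.1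
    exact PosDef.posSemidef_add h1 ((PosDef.one.add_posSemidef h2).smul hε)
  set P : ℝ → Matrix (Fin n) (Fin n) ℝ := fun t => (Ψ t)ᵀ * (N t)⁻¹ * Ψ t with hP
  set P' : ℝ → Matrix (Fin n) (Fin n) ℝ := fun t =>
    (-(P t * G t * (R t)⁻¹ * (G t)ᵀ * P t) - ε • (P t * P t)) - (A t)ᵀ * P t - P t * A t with hP'
  have hPp : ∀ t ∈ Icc t₀ (t₀ + T), (P t).PosDef := by
    intro t ht
    have hu : IsUnit (Ψ t) := ⟨⟨Ψ t, Φ t, hΨΦ t, hΦΨ t⟩, rfl⟩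
    have := (hNp t ht).inv.conjTranspose_mul_mul_same (B := Ψ t) (mulVec_injective_of_isUnit hu)
    simpa [conjTranspose_eq_transpose_of_trivial] using this
  have hPd : ∀ t ∈ Icc t₀ (t₀ + T), HasDerivWithinAt P (P' t) (Icc t₀ (t₀ + T)) t := by
    intro t ht
    have h1 := ((transpose_deriv (hΨ t ht)).mul
      (inv_deriv (hNd t) (hNp t ht).isUnit).hasDerivWithinAt).mul (hΨ t ht)
    refine h1.congr_deriv ?_
    simp only [hP', hP, hF, hH, transpose_neg, transpose_mul, Pi.mul_apply]
    simp only [Matrix.mul_add, Matrix.add_mul, Matrix.mul_neg, Matrix.neg_mul, Matrix.mul_assoc,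
      Matrix.smul_mul, Matrix.mul_smul]
    abel
  have hPc : ContinuousOn P (Icc t₀ (t₀ + T)) := fun t ht => (hPd t ht).continuousWithinAt
  have hP'c : ContinuousOn P' (Icc t₀ (t₀ + T)) := by
    rw [continuousOn_iff_continuous_domRestrict] at hPc ⊢
    have p : Continuous fun x : Icc t₀ (t₀ + T) => P x := hPc
    have a1 : Continuous fun x : Icc t₀ (t₀ + T) => A x := hA.comp continuous_subtype_val
    have a2 : Continuous fun x : Icc t₀ (t₀ + T) => G x := hG.comp continuous_subtype_val
    have a3 : Continuous fun x : Icc t₀ (t₀ + T) => (R x)⁻¹ := hRi.comp continuous_subtype_val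
    exact ((((((p.matrix_mul a2).matrix_mul a3).matrix_mul a2.matrix_transpose).matrix_mul p).neg.sub
      ((p.matrix_mul p).const_smul ε)).sub (a1.matrix_transpose.matrix_mul p)).sub (p.matrix_mul a1)
  refine ⟨P, P', hPp, fun i j => ?_, fun t ht i j => entry_deriv (hPd t ht) i j, fun t ht => ?_,
    fun t ht => ?_⟩
  · have : Continuous fun N : Matrix (Fin n) (Fin n) ℝ => N i j := by fun_prop
    exact this.comp_continuousOn hP'c
  · refine block_pd (G t) (hPp t ht) (hRpd t) hε ?_
    simp only [hP']
    abel
  · have hNu : IsUnit (N t).det := (isUnit_iff_isUnit_det _).1 (hNp t ht).isUnit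
    refine final_pd (W := Φ t * N t * (Φ t)ᵀ) (C t) ?_ (hPp t ht) ?_ (hQpd t) ?_
    · have := (hNp t ht).posSemidef.mul_mul_conjTranspose_same (Φ t)
      simpa [conjTranspose_eq_transpose_of_trivial] using this
    · have h1 : (Φ t)ᵀ * (Ψ t)ᵀ = 1 := by rw [← transpose_mul, hΨΦ, transpose_one]
      calc Φ t * N t * (Φ t)ᵀ * P t = Φ t * (N t * ((Φ t)ᵀ * (Ψ t)ᵀ) * (N t)⁻¹) * Ψ t := by
            simp only [hP, Matrix.mul_assoc]
        _ = 1 := by rw [h1, Matrix.mul_one, mul_nonsing_inv _ hNu, Matrix.mul_one, hΦΨ]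
    · intro y hy
      have hn : 0 < ‖y‖ := norm_pos_iff.2 hy
      have h1 := hεK (t, ‖y‖⁻¹ • y) ⟨ht, by simp [norm_smul, hn.ne']⟩
      simp only [f, g, u, mulVec_smul, dotProduct_smul, smul_dotProduct, smul_eq_mul] at h1
      have hWe : Φ t * N t * (Φ t)ᵀ =
          Φ t * M t * (Φ t)ᵀ + ε • (Φ t * (1 + D t) * (Φ t)ᵀ) := by
        simp only [hN, Matrix.mul_add, Matrix.add_mul, Matrix.smul_mul, Matrix.mul_smul]
      rw [hWe, add_mulVec, dotProduct_add, smul_mulVec, dotProduct_smul, smul_eq_mul]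
      have hi : 0 < ‖y‖⁻¹ * ‖y‖⁻¹ := by positivity
      refine lt_of_mul_lt_mul_left ?_ hi.le
      linarith

theorem dlmi_of_io_fts
    {n r m : ℕ} (t₀ T : ℝ) (hT : 0 < T)
    (A : ℝ → Matrix (Fin n) (Fin n) ℝ)
    (G : ℝ → Matrix (Fin n) (Fin r) ℝ)
    (C : ℝ → Matrix (Fin m) (Fin n) ℝ)
    (R : ℝ → Matrix (Fin r) (Fin r) ℝ)
    (Q : ℝ → Matrix (Fin m) (Fin m) ℝ)
    (hA : ∀ i j, ContinuousOn (fun t => A t i j) (Icc t₀ (t₀ + T)))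
    (hG : ∀ i j, ContinuousOn (fun t => G t i j) (Icc t₀ (t₀ + T)))
    (hC : ∀ i j, ContinuousOn (fun t => C t i j) (Icc t₀ (t₀ + T)))
    (hR : ∀ i j, ContinuousOn (fun t => R t i j) (Icc t₀ (t₀ + T)))
    (hQ : ∀ i j, ContinuousOn (fun t => Q t i j) (Icc t₀ (t₀ + T)))
    (hRpd : ∀ t ∈ Icc t₀ (t₀ + T), (R t).PosDef)
    (hQpd : ∀ t ∈ Icc t₀ (t₀ + T), (Q t).PosDef)
    -- IO-FTS with respect to `(W₂, Q(·), Ω)`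
    (hIOFTS : ∀ w : ℝ → Fin r → ℝ, Measurable w →
      IntervalIntegrable (fun τ => w τ ⬝ᵥ (R τ *ᵥ w τ)) volume t₀ (t₀ + T) →
      (∫ τ in t₀..(t₀ + T), w τ ⬝ᵥ (R τ *ᵥ w τ)) ≤ 1 →
      ∀ x : ℝ → Fin n → ℝ,
        (∀ t ∈ Icc t₀ (t₀ + T),
          IntervalIntegrable (fun τ => A τ *ᵥ x τ + G τ *ᵥ w τ) volume t₀ t ∧
          x t = ∫ τ in t₀..t, (A τ *ᵥ x τ + G τ *ᵥ w τ)) →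
        ∀ t ∈ Icc t₀ (t₀ + T), (C t *ᵥ x t) ⬝ᵥ (Q t *ᵥ (C t *ᵥ x t)) < 1) :
    -- existence of a solution of the DLMI/LMI
    ∃ P P' : ℝ → Matrix (Fin n) (Fin n) ℝ,
      (∀ t ∈ Icc t₀ (t₀ + T), (P t).PosDef) ∧
      (∀ i j, ContinuousOn (fun t => P' t i j) (Icc t₀ (t₀ + T))) ∧
      (∀ t ∈ Icc t₀ (t₀ + T), ∀ i j,
        HasDerivWithinAt (fun s => P s i j) (P' t i j) (Icc t₀ (t₀ + T)) t) ∧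
      (∀ t ∈ Icc t₀ (t₀ + T),
        (-(Matrix.fromBlocks (P' t + (A t)ᵀ * P t + P t * A t) (P t * G t)
            ((G t)ᵀ * P t) (-(R t)))).PosDef) ∧
      (∀ t ∈ Icc t₀ (t₀ + T), (P t - (C t)ᵀ * Q t * C t).PosDef) := by
  have hab : t₀ ≤ t₀ + T := by linarith
  let π : ℝ → ℝ := fun t => projIcc t₀ (t₀ + T) hab t
  have hπ : Continuous π := by fun_prop
  have hπm : ∀ t, π t ∈ Icc t₀ (t₀ + T) := fun t => (projIcc t₀ (t₀ + T) hab t).2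
  have hπe : ∀ t ∈ Icc t₀ (t₀ + T), π t = t := fun t ht => by simp [π, projIcc_of_mem hab ht]
  have hext : ∀ {k l : ℕ} (X : ℝ → Matrix (Fin k) (Fin l) ℝ),
      (∀ i j, ContinuousOn (fun t => X t i j) (Icc t₀ (t₀ + T))) → Continuous fun t => X (π t) := by
    intro k l X hX
    exact continuous_matrix fun i j => (hX i j).comp_continuous hπ hπm
  have hsub : ∀ t ∈ Icc t₀ (t₀ + T), uIcc t₀ t ⊆ Icc t₀ (t₀ + T) := fun t ht => by
    rw [uIcc_of_le ht.1]; exact Icc_subset_Icc_right ht.2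
  obtain ⟨P, P', h1, h2, h3, h4, h5⟩ := core t₀ T hT (fun t => A (π t)) (fun t => G (π t))
    (fun t => C (π t)) (fun t => R (π t)) (fun t => Q (π t)) (hext A hA) (hext G hG) (hext C hC)
    (hext R hR) (hext Q hQ) (fun t => hRpd _ (hπm t)) (fun t => hQpd _ (hπm t)) (by
      intro w hw hwi hwl x hx t ht
      have hT' : t₀ + T ∈ Icc t₀ (t₀ + T) := ⟨hab, le_rfl⟩
      have e1 : EqOn (fun τ => w τ ⬝ᵥ (R (π τ) *ᵥ w τ)) (fun τ => w τ ⬝ᵥ (R τ *ᵥ w τ))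
          (uIcc t₀ (t₀ + T)) := fun τ hτ => by simp only [hπe τ (hsub _ hT' hτ)]
      have e2 : ∀ t ∈ Icc t₀ (t₀ + T), EqOn (fun τ => A (π τ) *ᵥ x τ + G (π τ) *ᵥ w τ)
          (fun τ => A τ *ᵥ x τ + G τ *ᵥ w τ) (uIcc t₀ t) := fun t ht τ hτ => by
        simp only [hπe τ (hsub _ ht hτ)]
      have := hIOFTS w hw (hwi.congr (e1.mono uIoc_subset_uIcc))
        (by rwa [← intervalIntegral.integral_congr e1]) x
        (fun t ht => ⟨(hx t ht).1.congr ((e2 t ht).mono uIoc_subset_uIcc), by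
          rw [← intervalIntegral.integral_congr (e2 t ht)]; exact (hx t ht).2⟩) t ht
      simpa only [hπe t ht] using this)
  refine ⟨P, P', h1, h2, h3, fun t ht => ?_, fun t ht => ?_⟩
  · simpa only [hπe t ht] using h4 t ht
  · simpa only [hπe t ht] using h5 t ht
end

section
/- Let P : Ω → ℝ^{n×n} be a continuously differentiable symmetric positive definite matrix-valued function such that for every t ∈ Ω the block matrix [[Ṗ(t) + A(t)ᵀP(t) + P(t)A(t), P(t)G(t)], [G(t)ᵀP(t), −R(t)]] is negative definite. Then for every measurable, locally square-integrable input w : Ω → ℝ^r and every locally absolutely continuous x : Ω → ℝⁿ with x(t₀) = 0 satisfying ẋ(t) = A(t)x(t) + G(t)w(t) a.e. on Ω, one has x(t)ᵀP(t)x(t) ≤ ∫_{t₀}^{t} w(τ)ᵀR(τ)w(τ) dτ for all t ∈ Ω. -/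
open MeasureTheory Matrix Set

lemma lyap_ac_sum {ι : Type*} (s : Finset ι) {f : ι → ℝ → ℝ} {a b : ℝ}
    (h : ∀ i ∈ s, AbsolutelyContinuousOnInterval (f i) a b) :
    AbsolutelyContinuousOnInterval (fun t => ∑ i ∈ s, f i t) a b := by
  classical
  induction s using Finset.induction_on with
  | empty =>
    simp only [Finset.sum_empty]
    exact (LipschitzWith.const (0 : ℝ)).lipschitzOnWith.absolutelyContinuousOnInterval
  | insert i s hi ih =>
    simp only [Finset.sum_insert hi]
    exact (h i (by simp)).fun_add (ih (fun j hj => h j (by simp [hj])))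

lemma lyap_alg {n r : ℕ} (A P P' : Matrix (Fin n) (Fin n) ℝ) (G : Matrix (Fin n) (Fin r) ℝ)
    (R : Matrix (Fin r) (Fin r) ℝ)
    (h : (-(Matrix.fromBlocks (P' + Aᵀ * P + P * A) (P * G) (Gᵀ * P) (-R))).PosDef)
    (x : Fin n → ℝ) (w : Fin r → ℝ) :
    (A *ᵥ x + G *ᵥ w) ⬝ᵥ (P *ᵥ x) + (x ⬝ᵥ (P' *ᵥ x) + x ⬝ᵥ (P *ᵥ (A *ᵥ x + G *ᵥ w)))
      ≤ w ⬝ᵥ (R *ᵥ w) := by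
  have h1 := h.posSemidef.dotProduct_mulVec_nonneg (Sum.elim x w)
  have e1 : (A *ᵥ x) ⬝ᵥ (P *ᵥ x) = x ⬝ᵥ ((Aᵀ * P) *ᵥ x) := by
    rw [← mulVec_mulVec, dotProduct_mulVec x, vecMul_transpose]
  have e2 : (G *ᵥ w) ⬝ᵥ (P *ᵥ x) = w ⬝ᵥ ((Gᵀ * P) *ᵥ x) := by
    rw [← mulVec_mulVec, dotProduct_mulVec w, vecMul_transpose]
  rw [star_trivial, neg_mulVec, dotProduct_neg, fromBlocks_mulVec] at h1
  simp only [Sum.elim_comp_inl, Sum.elim_comp_inr, sumElim_dotProduct_sumElim, add_mulVec,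
    dotProduct_add, neg_mulVec, dotProduct_neg] at h1
  simp only [mulVec_add, add_dotProduct, dotProduct_add, mulVec_mulVec, e1, e2]
  linarith

/-- **Lyapunov bound along trajectories.** If `P(·)` is continuously differentiable,
symmetric positive definite and `[[Ṗ + AᵀP + PA, PG], [GᵀP, −R]] < 0` on `Ω = [t₀, t₀+T]`,
then every solution of `ẋ = A x + G w` with `x(t₀) = 0` satisfies
`x(t)ᵀP(t)x(t) ≤ ∫_{t₀}^{t} w(τ)ᵀR(τ)w(τ) dτ` for all `t ∈ Ω`. -/
theorem lyapunov_energy_bound_of_dlmi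
    {n r : ℕ} (t₀ T : ℝ) (hT : 0 < T)
    (A : ℝ → Matrix (Fin n) (Fin n) ℝ)
    (G : ℝ → Matrix (Fin n) (Fin r) ℝ)
    (R : ℝ → Matrix (Fin r) (Fin r) ℝ)
    (hA : ∀ i j, ContinuousOn (fun t => A t i j) (Icc t₀ (t₀ + T)))
    (hG : ∀ i j, ContinuousOn (fun t => G t i j) (Icc t₀ (t₀ + T)))
    (hR : ∀ i j, ContinuousOn (fun t => R t i j) (Icc t₀ (t₀ + T)))
    (hRpd : ∀ t ∈ Icc t₀ (t₀ + T), (R t).PosDef)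
    -- `P` continuously differentiable (with derivative `P'`), symmetric positive definite
    (P P' : ℝ → Matrix (Fin n) (Fin n) ℝ)
    (hPpd : ∀ t ∈ Icc t₀ (t₀ + T), (P t).PosDef)
    (hP'cont : ∀ i j, ContinuousOn (fun t => P' t i j) (Icc t₀ (t₀ + T)))
    (hPderiv : ∀ t ∈ Icc t₀ (t₀ + T), ∀ i j,
      HasDerivWithinAt (fun s => P s i j) (P' t i j) (Icc t₀ (t₀ + T)) t)
    -- the DLMI: `[[Ṗ + AᵀP + PA, PG], [GᵀP, −R]] < 0` on `Ω`
    (hDLMI : ∀ t ∈ Icc t₀ (t₀ + T),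
      (-(Matrix.fromBlocks (P' t + (A t)ᵀ * P t + P t * A t) (P t * G t)
          ((G t)ᵀ * P t) (-(R t)))).PosDef) :
    -- conclusion: the energy bound along every solution
    ∀ w : ℝ → Fin r → ℝ, Measurable w →
      IntervalIntegrable (fun τ => w τ ⬝ᵥ (R τ *ᵥ w τ)) volume t₀ (t₀ + T) →
      ∀ x : ℝ → Fin n → ℝ,
        (∀ t ∈ Icc t₀ (t₀ + T),
          IntervalIntegrable (fun τ => A τ *ᵥ x τ + G τ *ᵥ w τ) volume t₀ t ∧
          x t = ∫ τ in t₀..t, (A τ *ᵥ x τ + G τ *ᵥ w τ)) →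
        ∀ t ∈ Icc t₀ (t₀ + T),
          x t ⬝ᵥ (P t *ᵥ x t) ≤ ∫ τ in t₀..t, w τ ⬝ᵥ (R τ *ᵥ w τ) := by
  intro w hw hwR x hx t ht
  have ht0 : t₀ ≤ t := ht.1
  have hsub : Icc t₀ t ⊆ Icc t₀ (t₀ + T) := Icc_subset_Icc_right ht.2
  set f : ℝ → Fin n → ℝ := fun τ => A τ *ᵥ x τ + G τ *ᵥ w τ with hf
  have hfi : ∀ s ∈ Icc t₀ (t₀ + T), ∀ i, IntervalIntegrable (fun τ => f τ i) volume t₀ s := by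
    intro s hs i
    have := (hx s hs).1
    exact ⟨this.1.eval i, this.2.eval i⟩
  let y : Fin n → ℝ → ℝ := fun i s => ∫ τ in t₀..s, f τ i
  have hxy : ∀ s ∈ Icc t₀ (t₀ + T), ∀ i, x s i = y i s := by
    intro s hs i
    rw [(hx s hs).2]
    simp only [y, intervalIntegral.integral_of_le hs.1]
    exact eval_integral (fun i => (hfi s hs i).1) i
  have hyac : ∀ i, AbsolutelyContinuousOnInterval (y i) t₀ t := fun i =>
    (hfi t ht i).absolutelyContinuousOnInterval_intervalIntegral left_mem_uIcc
  have hPac : ∀ i j, AbsolutelyContinuousOnInterval (fun s => P s i j) t₀ t := by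
    intro i j
    obtain ⟨C, hC⟩ := isCompact_Icc.exists_bound_of_continuousOn (hP'cont i j)
    have hL := (convex_Icc t₀ (t₀ + T)).lipschitzOnWith_of_nnnorm_hasDerivWithin_le
      (C := C.toNNReal) (fun s hs => hPderiv s hs i j)
      (fun s hs => by
        have := hC s hs
        exact NNReal.coe_le_coe.1 (this.trans (Real.le_coe_toNNReal C)))
    refine LipschitzOnWith.absolutelyContinuousOnInterval (K := C.toNNReal) (hL.mono ?_)
    rw [uIcc_of_le ht0]; exact hsub
  let V : ℝ → ℝ := fun s => ∑ i, ∑ j, y i s * (P s i j * y j s)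
  have hVac : AbsolutelyContinuousOnInterval V t₀ t :=
    lyap_ac_sum _ fun i _ => lyap_ac_sum _ fun j _ => (hyac i).fun_mul ((hPac i j).fun_mul (hyac j))
  have hVx : x t ⬝ᵥ (P t *ᵥ x t) = V t := by
    simp only [V, dotProduct, mulVec, Finset.mul_sum, hxy t ht]
  have hV0 : V t₀ = 0 := by simp [V, y]
  have hFTC := hVac.integral_deriv_eq_sub
  rw [hV0, sub_zero] at hFTC
  rw [hVx, ← hFTC]
  have hyd : ∀ᵐ s, ∀ i, s ∈ uIcc t₀ t → HasDerivAt (y i) (f s i) s := by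
    rw [ae_all_iff]
    intro i
    filter_upwards [(hfi t ht i).ae_hasDerivAt_integral] with s hs hs'
    exact hs hs' t₀ left_mem_uIcc
  have hwR' : IntervalIntegrable (fun τ => w τ ⬝ᵥ (R τ *ᵥ w τ)) volume t₀ t := by
    refine hwR.mono_set ?_
    rw [uIcc_of_le ht0, uIcc_of_le (by linarith)]; exact hsub
  have hne : ∀ᵐ s : ℝ, s ≠ t := by simp [ae_iff, measure_singleton]
  refine intervalIntegral.integral_mono_ae_restrict ht0 hVac.intervalIntegrable_deriv hwR' ?_
  rw [Filter.EventuallyLE, ae_restrict_iff' measurableSet_Icc]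
  have hne0 : ∀ᵐ s : ℝ, s ≠ t₀ := by simp [ae_iff, measure_singleton]
  filter_upwards [hyd, hne, hne0] with s hs hst hst0 hsI
  have hsT := hsub hsI
  have hnh : Icc t₀ (t₀ + T) ∈ nhds s :=
    Icc_mem_nhds (lt_of_le_of_ne hsI.1 (Ne.symm hst0)) ((lt_of_le_of_ne hsI.2 hst).trans_le ht.2)
  have hsu : s ∈ uIcc t₀ t := by rw [uIcc_of_le ht0]; exact hsI
  have hVd : HasDerivAt V (∑ i, ∑ j, (f s i * (P s i j * y j s) +
      y i s * (P' s i j * y j s + P s i j * f s j))) s := by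
    refine HasDerivAt.fun_sum fun i _ => HasDerivAt.fun_sum fun j _ => ?_
    exact (hs i hsu).fun_mul (((hPderiv s hsT i j).hasDerivAt hnh).fun_mul (hs j hsu))
  rw [hVd.deriv]
  refine le_trans (le_of_eq ?_) (lyap_alg (A s) (P s) (P' s) (G s) (R s) (hDLMI s hsT) (x s) (w s))
  change _ = f s ⬝ᵥ (P s *ᵥ x s) + (x s ⬝ᵥ (P' s *ᵥ x s) + x s ⬝ᵥ (P s *ᵥ f s))
  simp only [dotProduct, mulVec, Finset.mul_sum, hxy s hsT, ← Finset.sum_add_distrib, mul_add]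
end

section
/- Consider the linear time-varying system ẋ(t) = A(t)x(t) + G(t)w(t) with x(t₀) = 0 and output y(t) = C(t)x(t) on Ω = [t₀, t₀+T], and let Φ(t, τ) denote its state transition matrix (the solution of ∂Φ(t,τ)/∂t = A(t)Φ(t,τ), Φ(τ,τ) = I). Fix t̄ ∈ Ω and define the weighted reachability Gramian W(t̄) = ∫_{t₀}^{t̄} Φ(t̄, τ)G(τ)R(τ)⁻¹G(τ)ᵀΦ(t̄, τ)ᵀ dτ. Then the supremum, over all measurable inputs w : Ω → ℝ^r with ∫_Ω w(τ)ᵀR(τ)w(τ) dτ ≤ 1, of the weighted output energy y(t̄)ᵀQ(t̄)y(t̄) equals λ_max(Q(t̄)^{1/2} C(t̄) W(t̄) C(t̄)ᵀ Q(t̄)^{1/2}), and this supremum is attained by some admissible input. -/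
open MeasureTheory Matrix Set

lemma aux_mul {a b c : ℕ} {s : Set ℝ} {f : ℝ → Matrix (Fin a) (Fin b) ℝ}
    {g : ℝ → Matrix (Fin b) (Fin c) ℝ} (hf : ContinuousOn f s) (hg : ContinuousOn g s) :
    ContinuousOn (fun t => f t * g t) s :=
  (continuous_fst.matrix_mul continuous_snd).comp_continuousOn (hf.prodMk hg)

lemma aux_mulVec {a b : ℕ} {s : Set ℝ} {f : ℝ → Matrix (Fin a) (Fin b) ℝ}
    {g : ℝ → (Fin b) → ℝ} (hf : ContinuousOn f s) (hg : ContinuousOn g s) :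
    ContinuousOn (fun t => f t *ᵥ g t) s :=
  (continuous_fst.matrix_mulVec continuous_snd).comp_continuousOn (hf.prodMk hg)

lemma aux_dot {b : ℕ} {s : Set ℝ} {f : ℝ → (Fin b) → ℝ}
    {g : ℝ → (Fin b) → ℝ} (hf : ContinuousOn f s) (hg : ContinuousOn g s) :
    ContinuousOn (fun t => f t ⬝ᵥ g t) s :=
  (Continuous.dotProduct continuous_fst continuous_snd).comp_continuousOn (hf.prodMk hg)

lemma aux_tr {a b : ℕ} {s : Set ℝ} {f : ℝ → Matrix (Fin a) (Fin b) ℝ}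
    (hf : ContinuousOn f s) : ContinuousOn (fun t => (f t)ᵀ) s :=
  (continuous_id.matrix_transpose).comp_continuousOn hf

lemma aux_entries {a b : ℕ} {s : Set ℝ} {f : ℝ → Matrix (Fin a) (Fin b) ℝ}
    (hf : ∀ i j, ContinuousOn (fun t => f t i j) s) : ContinuousOn f s :=
  continuousOn_pi.2 fun i => continuousOn_pi.2 fun j => hf i j

lemma aux_inv_s13 {a : ℕ} {s : Set ℝ} {f : ℝ → Matrix (Fin a) (Fin a) ℝ}
    (hf : ContinuousOn f s) (hu : ∀ t ∈ s, IsUnit (f t).det) :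
    ContinuousOn (fun t => (f t)⁻¹) s := by
  intro t ht
  have h : ContinuousAt Inv.inv (f t) := continuousAt_matrix_inv (f t) (by
    rw [Ring.inverse_eq_inv']
    exact continuousAt_inv₀ (hu t ht).ne_zero)
  exact h.comp_continuousWithinAt (hf t ht)

lemma aux_unique {n : ℕ} {a b : ℝ} {A : ℝ → Matrix (Fin n) (Fin n) ℝ}
    (hA : ∀ i j, ContinuousOn (fun t => A t i j) (Icc a b))
    {f g : ℝ → Fin n → ℝ}
    (hf : ∀ t ∈ Icc a b, HasDerivWithinAt f (A t *ᵥ f t) (Icc a b) t)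
    (hg : ∀ t ∈ Icc a b, HasDerivWithinAt g (A t *ᵥ g t) (Icc a b) t)
    {τ : ℝ} (hτ : τ ∈ Icc a b) (h : f τ = g τ) : ∀ t ∈ Icc a b, f t = g t := by
  have hb : ∀ i j, ∃ k, ∀ t ∈ Icc a b, ‖A t i j‖ ≤ k := fun i j =>
    isCompact_Icc.exists_bound_of_continuousOn (hA i j)
  choose k hk using hb
  set K : NNReal := ∑ i, ∑ j, (k i j).toNNReal with hK
  have hlip : ∀ t ∈ Icc a b, LipschitzOnWith K (fun x => A t *ᵥ x) univ := by
    intro t ht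
    apply LipschitzOnWith.of_dist_le_mul
    intro x _ y _
    rw [dist_eq_norm, dist_eq_norm, ← mulVec_sub]
    refine (pi_norm_le_iff_of_nonneg (by positivity)).2 fun i => ?_
    have h1 : ‖(A t *ᵥ (x - y)) i‖ ≤ ∑ j, ((k i j).toNNReal : ℝ) * ‖x - y‖ := by
      change ‖∑ j, A t i j * (x - y) j‖ ≤ _
      refine (norm_sum_le _ _).trans (Finset.sum_le_sum fun j _ => ?_)
      rw [norm_mul]
      refine mul_le_mul ((hk i j t ht).trans (Real.le_coe_toNNReal _)) (norm_le_pi_norm _ _) (norm_nonneg _) (by positivity)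
    refine h1.trans ?_
    rw [← Finset.sum_mul]
    refine mul_le_mul_of_nonneg_right ?_ (norm_nonneg _)
    rw [hK]; push_cast
    exact Finset.single_le_sum (f := fun i => ∑ j, ((k i j).toNNReal : ℝ)) (fun i _ => by positivity) (Finset.mem_univ i)
  have hfc : ContinuousOn f (Icc a b) := fun t ht => (hf t ht).continuousWithinAt
  have hgc : ContinuousOn g (Icc a b) := fun t ht => (hg t ht).continuousWithinAt
  have s1 : Icc τ b ⊆ Icc a b := Icc_subset_Icc_left hτ.1
  have s2 : Icc a τ ⊆ Icc a b := Icc_subset_Icc_right hτ.2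
  have key : ∀ {f : ℝ → Fin n → ℝ}, (∀ t ∈ Icc a b, HasDerivWithinAt f (A t *ᵥ f t) (Icc a b) t) →
    (∀ t ∈ Ico τ b, HasDerivWithinAt f (A t *ᵥ f t) (Ici t) t) ∧ (∀ t ∈ Ioc a τ, HasDerivWithinAt f (A t *ᵥ f t) (Iic t) t) := by
    intro f hf
    constructor
    · intro t ht
      refine (hf t (s1 (Ico_subset_Icc_self ht))).mono_of_mem_nhdsWithin ?_
      exact Filter.mem_of_superset (Icc_mem_nhdsGE ht.2) (Icc_subset_Icc_left (hτ.1.trans ht.1))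
    · intro t ht
      refine (hf t (s2 (Ioc_subset_Icc_self ht))).mono_of_mem_nhdsWithin ?_
      exact Filter.mem_of_superset (Icc_mem_nhdsLE ht.1) (Icc_subset_Icc_right (ht.2.trans hτ.2))
  intro t ht
  rcases le_total τ t with h' | h'
  · exact ODE_solution_unique_of_mem_Icc_right (v := fun t x => A t *ᵥ x) (s := fun _ => univ) (K := K)
      (fun t ht => hlip t (s1 (Ico_subset_Icc_self ht))) (hfc.mono s1) (key hf).1 (fun _ _ => trivial)
      (hgc.mono s1) (key hg).1 (fun _ _ => trivial) h ⟨h', ht.2⟩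
  · exact ODE_solution_unique_of_mem_Icc_left (v := fun t x => A t *ᵥ x) (s := fun _ => univ) (K := K)
      (fun t ht => hlip t (s2 (Ioc_subset_Icc_self ht))) (hfc.mono s2) (key hf).2 (fun _ _ => trivial)
      (hgc.mono s2) (key hg).2 (fun _ _ => trivial) h ⟨ht.1, h'⟩

lemma aux_trans {n : ℕ} {a b : ℝ} (hab : a ≤ b) {A : ℝ → Matrix (Fin n) (Fin n) ℝ}
    (hA : ∀ i j, ContinuousOn (fun t => A t i j) (Icc a b))
    (Φ : ℝ → ℝ → Matrix (Fin n) (Fin n) ℝ)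
    (hΦid : ∀ τ ∈ Icc a b, Φ τ τ = 1)
    (hΦode : ∀ τ ∈ Icc a b, ∀ t ∈ Icc a b, ∀ i j,
      HasDerivWithinAt (fun s => Φ s τ i j) ((A t * Φ t τ) i j) (Icc a b) t)
    {tb : ℝ} (htb : tb ∈ Icc a b) : ContinuousOn (fun τ => Φ tb τ) (Icc a b) := by
  have ha : a ∈ Icc a b := ⟨le_rfl, hab⟩
  have hcomp : ∀ τ ∈ Icc a b, ∀ s ∈ Icc a b, Φ s τ * Φ τ a = Φ s a := by
    intro τ hτ s hs
    ext i j
    have := aux_unique hA (f := fun s i => (Φ s τ * Φ τ a) i j) (g := fun s i => Φ s a i j)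
      (by
        intro t ht
        rw [hasDerivWithinAt_pi]
        intro i
        have : (A t *ᵥ fun i => (Φ t τ * Φ τ a) i j) i = ∑ l, (A t * Φ t τ) i l * Φ τ a l j := by
          have : (A t * (Φ t τ * Φ τ a)) i j = ((A t * Φ t τ) * Φ τ a) i j := by rw [Matrix.mul_assoc]
          exact this
        rw [this]
        simp only [Matrix.mul_apply (M := Φ _ τ)]
        exact HasDerivWithinAt.fun_sum fun l _ => (hΦode τ hτ t ht i l).mul_const _)
      (by
        intro t ht
        rw [hasDerivWithinAt_pi]
        intro i
        exact hΦode a ha t ht i j)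
      hτ (by simp [hΦid τ hτ]) s hs
    exact congrFun this i
  have hcont : ContinuousOn (fun τ => Φ τ a) (Icc a b) :=
    aux_entries fun i j t ht => (hΦode a ha t ht i j).continuousWithinAt
  have hunit : ∀ τ ∈ Icc a b, IsUnit (Φ τ a).det := by
    intro τ hτ
    have := hcomp τ hτ a ha
    rw [hΦid a ha] at this
    exact isUnit_det_of_left_inverse this
  refine (aux_mul (continuousOn_const (c := Φ tb a)) (aux_inv_s13 hcont hunit)).congr ?_
  intro τ hτ
  simp only
  rw [← hcomp τ hτ tb htb, Matrix.mul_assoc, Matrix.mul_nonsing_inv _ (hunit τ hτ), Matrix.mul_one]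

lemma aux_rayleigh {m : ℕ} {M : Matrix (Fin m) (Fin m) ℝ} (hM : M.IsHermitian) (z : Fin m → ℝ) :
    z ⬝ᵥ (M *ᵥ z) ≤ (⨆ i, hM.eigenvalues i) * (z ⬝ᵥ z) := by
  set μ := ⨆ i, hM.eigenvalues i
  set U : Matrix (Fin m) (Fin m) ℝ := hM.eigenvectorUnitary.1
  have hU : U * star U = 1 := Unitary.coe_mul_star_self _
  have hs : M = U * diagonal hM.eigenvalues * star U := by
    have := hM.spectral_theorem
    simpa [Unitary.conjStarAlgAut_apply] using this
  have hz : z = U *ᵥ (star U *ᵥ z) := by rw [mulVec_mulVec, hU, one_mulVec]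
  set q := star U *ᵥ z with hq
  have hq' : q = z ᵥ* U := by
    rw [hq, star_eq_conjTranspose, conjTranspose_eq_transpose_of_trivial, mulVec_transpose]
  have e1 : z ⬝ᵥ (M *ᵥ z) = ∑ i, hM.eigenvalues i * (q i * q i) := by
    have h1 : M *ᵥ z = U *ᵥ (diagonal hM.eigenvalues *ᵥ q) := by
      have := congrArg (fun N => N *ᵥ z) hs
      simp only [← mulVec_mulVec] at this
      exact this
    rw [h1, dotProduct_mulVec, ← hq']
    simp only [dotProduct, mulVec_diagonal]
    exact Finset.sum_congr rfl fun i _ => by ring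
  have e2 : z ⬝ᵥ z = ∑ i, q i * q i := by
    conv_lhs => rw [hz, dotProduct_mulVec, ← hz, ← hq']
    rfl
  rw [e1, e2, Finset.mul_sum]
  refine Finset.sum_le_sum fun i _ => mul_le_mul_of_nonneg_right ?_ (mul_self_nonneg _)
  exact le_ciSup (Set.finite_range _).bddAbove i

lemma aux_dot_int {n : ℕ} {a b : ℝ} (p : Fin n → ℝ) {f : ℝ → Fin n → ℝ}
    (hf : IntervalIntegrable f volume a b) :
    IntervalIntegrable (fun τ => p ⬝ᵥ f τ) volume a b ∧
    p ⬝ᵥ (∫ τ in a..b, f τ) = ∫ τ in a..b, p ⬝ᵥ f τ := by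
  set L : (Fin n → ℝ) →L[ℝ] ℝ := LinearMap.toContinuousLinearMap (dotProductBilin ℝ ℝ p)
  have hL : ∀ x, L x = p ⬝ᵥ x := fun x => rfl
  simp only [← hL]
  exact ⟨⟨L.integrable_comp hf.1, L.integrable_comp hf.2⟩, (L.intervalIntegral_comp_comm hf).symm⟩

lemma aux_core {n r m : ℕ} (hm : 0 < m) {t₀ t₁ tb : ℝ} (htb : tb ∈ Icc t₀ t₁)
    {B : ℝ → Matrix (Fin n) (Fin r) ℝ} {R : ℝ → Matrix (Fin r) (Fin r) ℝ}
    (hB : ContinuousOn B (Icc t₀ t₁)) (hR : ContinuousOn R (Icc t₀ t₁))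
    (hRpd : ∀ t ∈ Icc t₀ t₁, (R t).PosDef)
    (W : Matrix (Fin n) (Fin n) ℝ)
    (hW : ∀ i j, W i j = ∫ τ in t₀..tb, (B τ * (R τ)⁻¹ * (B τ)ᵀ) i j)
    (D : Matrix (Fin m) (Fin n) ℝ) (hH : (D * W * Dᵀ).IsHermitian) :
    IsGreatest
      {v : ℝ | ∃ w : ℝ → Fin r → ℝ, Measurable w ∧
        IntervalIntegrable (fun τ => w τ ⬝ᵥ (R τ *ᵥ w τ)) volume t₀ t₁ ∧
        (∫ τ in t₀..t₁, w τ ⬝ᵥ (R τ *ᵥ w τ)) ≤ 1 ∧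
        IntervalIntegrable (fun τ => B τ *ᵥ w τ) volume t₀ tb ∧
        v = (D *ᵥ ∫ τ in t₀..tb, B τ *ᵥ w τ) ⬝ᵥ (D *ᵥ ∫ τ in t₀..tb, B τ *ᵥ w τ)}
      (⨆ i, hH.eigenvalues i) := by
  have hsub : Icc t₀ tb ⊆ Icc t₀ t₁ := Icc_subset_Icc_right htb.2
  have hunit : ∀ t ∈ Icc t₀ t₁, IsUnit (R t).det := fun t ht => (hRpd t ht).det_pos.ne'.isUnit
  have hRi : ContinuousOn (fun t => (R t)⁻¹) (Icc t₀ t₁) := aux_inv_s13 hR hunit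
  have hsymm : ∀ t ∈ Icc t₀ t₁, (R t)ᵀ = R t := fun t ht => by
    have := (hRpd t ht).isHermitian.eq
    rwa [conjTranspose_eq_transpose_of_trivial] at this
  have hRnn : ∀ t ∈ Icc t₀ t₁, ∀ x, 0 ≤ x ⬝ᵥ (R t *ᵥ x) := fun t ht x => by
    simpa using (hRpd t ht).posSemidef.dotProduct_mulVec_nonneg x
  have hII : ∀ {E : Type} [NormedAddCommGroup E] {f : ℝ → E}, ContinuousOn f (Icc t₀ t₁) →
      IntervalIntegrable f volume t₀ tb := fun hf =>
    ContinuousOn.intervalIntegrable (by rw [uIcc_of_le htb.1]; exact hf.mono hsub)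
  set u : (Fin n → ℝ) → ℝ → Fin r → ℝ := fun p τ => (R τ)⁻¹ *ᵥ ((B τ)ᵀ *ᵥ p) with hu
  have huc : ∀ p, ContinuousOn (u p) (Icc t₀ t₁) := fun p =>
    aux_mulVec hRi (aux_mulVec (aux_tr hB) continuousOn_const)
  have hRu : ∀ p, ∀ τ ∈ Icc t₀ t₁, R τ *ᵥ u p τ = (B τ)ᵀ *ᵥ p := fun p τ hτ => by
    simp only [hu]
    rw [mulVec_mulVec, Matrix.mul_nonsing_inv _ (hunit τ hτ), one_mulVec]
  have hcross : ∀ p, ∀ τ ∈ Icc t₀ t₁, ∀ x, x ⬝ᵥ (R τ *ᵥ u p τ) = p ⬝ᵥ (B τ *ᵥ x) := fun p τ hτ x => by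
    rw [hRu p τ hτ, mulVec_transpose, dotProduct_comm, ← dotProduct_mulVec]
  have hcross' : ∀ p, ∀ τ ∈ Icc t₀ t₁, ∀ x, u p τ ⬝ᵥ (R τ *ᵥ x) = p ⬝ᵥ (B τ *ᵥ x) := fun p τ hτ x => by
    rw [← hcross p τ hτ x, dotProduct_mulVec, ← mulVec_transpose, hsymm τ hτ, dotProduct_comm]
  have hBu : ∀ p, IntervalIntegrable (fun τ => B τ *ᵥ u p τ) volume t₀ tb := fun p =>
    hII (aux_mulVec hB (huc p))
  -- Gramian as integral
  have hWp : ∀ p q, q ⬝ᵥ (W *ᵥ p) = ∫ τ in t₀..tb, q ⬝ᵥ (B τ *ᵥ u p τ) := by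
    intro p q
    have hN : ContinuousOn (fun τ => B τ * (R τ)⁻¹ * (B τ)ᵀ) (Icc t₀ t₁) :=
      aux_mul (aux_mul hB hRi) (aux_tr hB)
    have hNe : ∀ i j, ContinuousOn (fun τ => (B τ * (R τ)⁻¹ * (B τ)ᵀ) i j) (Icc t₀ t₁) := fun i j =>
      continuousOn_pi.1 (continuousOn_pi.1 hN i) j
    have e : ∀ τ, q ⬝ᵥ (B τ *ᵥ u p τ) = ∑ i, ∑ j, q i * ((B τ * (R τ)⁻¹ * (B τ)ᵀ) i j * p j) := by
      intro τ
      simp only [hu]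
      rw [mulVec_mulVec, mulVec_mulVec]
      simp only [dotProduct, mulVec, Finset.mul_sum]
    simp only [e]
    rw [intervalIntegral.integral_finsetSum]
    · simp only [dotProduct, mulVec, Finset.mul_sum]
      refine Finset.sum_congr rfl fun i _ => ?_
      rw [intervalIntegral.integral_finsetSum]
      · refine Finset.sum_congr rfl fun j _ => ?_
        rw [intervalIntegral.integral_const_mul, intervalIntegral.integral_mul_const, hW]
      · intro j _
        exact hII (continuousOn_const.mul ((hNe i j).mul continuousOn_const))
    · intro i _
      exact hII (continuousOn_finsetSum _ fun j _ => continuousOn_const.mul ((hNe i j).mul continuousOn_const))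
  have hWint : ∀ p, W *ᵥ p = ∫ τ in t₀..tb, B τ *ᵥ u p τ := by
    intro p
    refine dotProduct_eq _ _ fun q => ?_
    rw [dotProduct_comm, hWp, dotProduct_comm, (aux_dot_int q (hBu p)).2]
  have hquad : ∀ p, p ⬝ᵥ (W *ᵥ p) = ∫ τ in t₀..tb, u p τ ⬝ᵥ (R τ *ᵥ u p τ) := by
    intro p
    rw [hWp]
    refine intervalIntegral.integral_congr fun τ hτ => ?_
    rw [uIcc_of_le htb.1] at hτ
    exact (hcross p τ (hsub hτ) _).symm
  have huu : ∀ p, ContinuousOn (fun τ => u p τ ⬝ᵥ (R τ *ᵥ u p τ)) (Icc t₀ t₁) := fun p =>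
    aux_dot (huc p) (aux_mulVec hR (huc p))
  have hM : ∀ z, z ⬝ᵥ ((D * W * Dᵀ) *ᵥ z) = (Dᵀ *ᵥ z) ⬝ᵥ (W *ᵥ (Dᵀ *ᵥ z)) := by
    intro z
    rw [← mulVec_mulVec, ← mulVec_mulVec, dotProduct_mulVec, ← mulVec_transpose]
  have hMnn : ∀ z, 0 ≤ z ⬝ᵥ ((D * W * Dᵀ) *ᵥ z) := by
    intro z
    rw [hM, hquad]
    exact intervalIntegral.integral_nonneg htb.1 fun τ hτ => hRnn τ (hsub hτ) _
  have : Nonempty (Fin m) := ⟨⟨0, hm⟩⟩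
  obtain ⟨i, hi⟩ := exists_eq_ciSup_of_finite (f := hH.eigenvalues)
  have hray := aux_rayleigh hH
  set μ := ⨆ i, hH.eigenvalues i with hμ
  set z : Fin m → ℝ := ⇑(hH.eigenvectorBasis i) with hz
  have hzM : (D * W * Dᵀ) *ᵥ z = μ • z := by rw [← hi]; exact hH.mulVec_eigenvectorBasis i
  have hzz : z ⬝ᵥ z = 1 := by
    have h1 := hH.eigenvectorBasis.orthonormal.1 i
    have h2 : inner ℝ (hH.eigenvectorBasis i) (hH.eigenvectorBasis i) = (1 : ℝ) := by
      rw [real_inner_self_eq_norm_sq, h1]; norm_num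
    rw [EuclideanSpace.inner_eq_star_dotProduct] at h2
    simpa [hz] using h2
  have hμ0 : 0 ≤ μ := by
    have := hMnn z
    rw [hzM, dotProduct_smul, hzz] at this
    simpa using this
  constructor
  · set c : ℝ := (√μ)⁻¹ with hc
    set p := Dᵀ *ᵥ z with hp
    have hc2 : c * c * μ ≤ 1 := by
      rcases hμ0.eq_or_lt with h | h
      · rw [← h]; simp
      · have : √μ * √μ = μ := Real.mul_self_sqrt hμ0
        have h3 : 0 < √μ := Real.sqrt_pos.2 h
        rw [hc, ← this]; field_simp; norm_num
    have hc3 : c * c * (μ * μ) = μ := by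
      rcases hμ0.eq_or_lt with h | h
      · rw [← h]; simp
      · have : √μ * √μ = μ := Real.mul_self_sqrt hμ0
        have h3 : 0 < √μ := Real.sqrt_pos.2 h
        have : c * c * μ = 1 := by
          rw [hc]; nth_rewrite 3 [← this]; field_simp
        rw [← mul_assoc, this, one_mul]
    classical
    set w : ℝ → Fin r → ℝ := (Icc t₀ tb).piecewise (fun τ => c • u p τ) (fun _ => 0) with hw
    have hw1 : ∀ τ ∈ Icc t₀ tb, w τ = c • u p τ := fun τ hτ => piecewise_eq_of_mem _ _ _ hτ
    have hw2 : ∀ τ ∉ Icc t₀ tb, w τ = 0 := fun τ hτ => piecewise_eq_of_notMem _ _ _ hτ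
    have hq1 : ∀ τ ∈ Icc t₀ tb, w τ ⬝ᵥ (R τ *ᵥ w τ) = c * c * (u p τ ⬝ᵥ (R τ *ᵥ u p τ)) := fun τ hτ => by
      rw [hw1 τ hτ, mulVec_smul, dotProduct_smul, smul_dotProduct, smul_eq_mul, smul_eq_mul, mul_assoc]
    have hq2 : ∀ τ ∈ Ioc tb t₁, w τ ⬝ᵥ (R τ *ᵥ w τ) = 0 := fun τ hτ => by
      rw [hw2 τ (fun h => absurd hτ.1 (not_lt.2 h.2))]; simp
    have hBw : ∀ τ ∈ Icc t₀ tb, B τ *ᵥ w τ = c • (B τ *ᵥ u p τ) := fun τ hτ => by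
      rw [hw1 τ hτ, mulVec_smul]
    have hi1 : IntervalIntegrable (fun τ => w τ ⬝ᵥ (R τ *ᵥ w τ)) volume t₀ tb := by
      refine (hII ((huu p).const_smul (c * c))).congr ?_
      intro τ hτ
      rw [uIoc_of_le htb.1] at hτ
      exact (hq1 τ (Ioc_subset_Icc_self hτ)).symm
    have hi2 : IntervalIntegrable (fun τ => w τ ⬝ᵥ (R τ *ᵥ w τ)) volume tb t₁ := by
      refine (intervalIntegrable_const (c := (0:ℝ))).congr ?_
      intro τ hτ
      rw [uIoc_of_le htb.2] at hτ
      exact (hq2 τ hτ).symm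
    refine ⟨w, ?_, hi1.trans hi2, ?_, ?_, ?_⟩
    · exact ContinuousOn.measurable_piecewise (((huc p).mono hsub).const_smul c) continuousOn_const measurableSet_Icc
    · rw [← intervalIntegral.integral_add_adjacent_intervals hi1 hi2]
      have e2 : ∫ τ in tb..t₁, w τ ⬝ᵥ (R τ *ᵥ w τ) = 0 := by
        rw [intervalIntegral.integral_of_le htb.2, setIntegral_congr_fun measurableSet_Ioc hq2]
        simp
      have e1 : ∫ τ in t₀..tb, w τ ⬝ᵥ (R τ *ᵥ w τ) = c * c * μ := by
        rw [intervalIntegral.integral_congr (g := fun τ => c * c * (u p τ ⬝ᵥ (R τ *ᵥ u p τ)))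
          (fun τ hτ => hq1 τ (by rwa [uIcc_of_le htb.1] at hτ)), intervalIntegral.integral_const_mul,
          ← hquad, hp, ← hM, hzM, dotProduct_smul, hzz]
        simp
      rw [e1, e2, add_zero]; exact hc2
    · refine ((hBu p).smul c).congr ?_
      intro τ hτ
      rw [uIoc_of_le htb.1] at hτ
      exact (hBw τ (Ioc_subset_Icc_self hτ)).symm
    · have e : ∫ τ in t₀..tb, B τ *ᵥ w τ = c • (W *ᵥ p) := by
        rw [intervalIntegral.integral_congr (g := fun τ => c • (B τ *ᵥ u p τ))
          (fun τ hτ => hBw τ (by rwa [uIcc_of_le htb.1] at hτ)), intervalIntegral.integral_smul, hWint]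
      have e' : D *ᵥ (W *ᵥ p) = μ • z := by
        rw [← hzM, hp, mulVec_mulVec, mulVec_mulVec, Matrix.mul_assoc]
      rw [e, mulVec_smul, e']
      simp only [dotProduct_smul, smul_dotProduct, hzz, smul_eq_mul]
      linarith
  · rintro v ⟨w, -, hwi, hw1, hBi, rfl⟩
    set x := ∫ τ in t₀..tb, B τ *ᵥ w τ with hx
    set y := D *ᵥ x with hy
    set s := y ⬝ᵥ y with hs
    have hs0 : 0 ≤ s := by
      have := Finset.sum_nonneg (s := Finset.univ) (fun i _ => mul_self_nonneg (y i))
      exact this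
    set p := Dᵀ *ᵥ y with hp
    have hsp : s = ∫ τ in t₀..tb, p ⬝ᵥ (B τ *ᵥ w τ) := by
      rw [← (aux_dot_int p hBi).2, ← hx, hp, mulVec_transpose, ← dotProduct_mulVec]
    have hwi1 : IntervalIntegrable (fun τ => w τ ⬝ᵥ (R τ *ᵥ w τ)) volume t₀ tb :=
      hwi.mono_set (by rw [uIcc_of_le htb.1, uIcc_of_le (htb.1.trans htb.2)]; exact hsub)
    have hwi2 : IntervalIntegrable (fun τ => w τ ⬝ᵥ (R τ *ᵥ w τ)) volume tb t₁ :=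
      hwi.mono_set (by rw [uIcc_of_le htb.2, uIcc_of_le (htb.1.trans htb.2)]; exact Icc_subset_Icc_left htb.1)
    have hE : ∫ τ in t₀..tb, w τ ⬝ᵥ (R τ *ᵥ w τ) ≤ 1 := by
      rw [← intervalIntegral.integral_add_adjacent_intervals hwi1 hwi2] at hw1
      have : 0 ≤ ∫ τ in tb..t₁, w τ ⬝ᵥ (R τ *ᵥ w τ) :=
        intervalIntegral.integral_nonneg htb.2 fun τ hτ => hRnn τ ⟨htb.1.trans hτ.1, hτ.2⟩ _
      linarith
    have key : ∀ c : ℝ, 2 * c * s ≤ c * c * (μ * s) + 1 := by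
      intro c
      have h1 : ∫ τ in t₀..tb, 2 * c * (p ⬝ᵥ (B τ *ᵥ w τ)) ≤
          ∫ τ in t₀..tb, (c * c * (u p τ ⬝ᵥ (R τ *ᵥ u p τ)) + w τ ⬝ᵥ (R τ *ᵥ w τ)) := by
        refine intervalIntegral.integral_mono_on htb.1 ((aux_dot_int p hBi).1.const_mul _)
          (((hII (huu p)).const_mul _).add hwi1) ?_
        intro τ hτ
        have h2 := hRnn τ (hsub hτ) (c • u p τ - w τ)
        simp only [mulVec_sub, mulVec_smul, dotProduct_sub, sub_dotProduct, smul_dotProduct,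
          dotProduct_smul, smul_eq_mul] at h2
        rw [hcross' p τ (hsub hτ) (w τ), hcross p τ (hsub hτ) (w τ)] at h2
        linarith
      rw [intervalIntegral.integral_const_mul, ← hsp, intervalIntegral.integral_add
        ((hII (huu p)).const_mul _) hwi1, intervalIntegral.integral_const_mul, ← hquad, hp, ← hM] at h1
      have h3 := mul_le_mul_of_nonneg_left (hray y) (mul_self_nonneg c)
      linarith
    rcases hs0.eq_or_lt with h | h
    · rw [← h]; exact hμ0
    rcases hμ0.eq_or_lt with h' | h'
    · have := key s⁻¹
      rw [← h', mul_assoc, inv_mul_cancel₀ h.ne'] at this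
      norm_num at this
    · have := key μ⁻¹
      have e : μ⁻¹ * μ⁻¹ * (μ * s) = μ⁻¹ * s := by field_simp
      rw [e] at this
      have h5 : μ⁻¹ * s ≤ 1 := by linarith
      rwa [inv_mul_le_iff₀ h', mul_one] at h5

/-- **The worst-case weighted output energy at a fixed time equals the largest eigenvalue
of the weighted reachability Gramian.** For the system `ẋ = A x + G w`, `x(t₀) = 0`,
`y = C x`, with state transition matrix `Φ` and weighted reachability Gramian
`W(t̄) = ∫_{t₀}^{t̄} Φ(t̄,τ)G(τ)R(τ)⁻¹G(τ)ᵀΦ(t̄,τ)ᵀ dτ`, the supremum over all inputs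
`w` with `∫_Ω wᵀRw ≤ 1` of `y(t̄)ᵀQ(t̄)y(t̄)` equals
`λ_max(Q(t̄)^{1/2} C(t̄) W(t̄) C(t̄)ᵀ Q(t̄)^{1/2})`, and it is attained. -/
theorem sup_weighted_output_energy_eq_gramian_eigenvalue
    {n r m : ℕ} (hm : 0 < m) (t₀ T : ℝ) (hT : 0 < T)
    (A : ℝ → Matrix (Fin n) (Fin n) ℝ)
    (G : ℝ → Matrix (Fin n) (Fin r) ℝ)
    (C : ℝ → Matrix (Fin m) (Fin n) ℝ)
    (R : ℝ → Matrix (Fin r) (Fin r) ℝ)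
    (Q : ℝ → Matrix (Fin m) (Fin m) ℝ)
    (hA : ∀ i j, ContinuousOn (fun t => A t i j) (Icc t₀ (t₀ + T)))
    (hG : ∀ i j, ContinuousOn (fun t => G t i j) (Icc t₀ (t₀ + T)))
    (hC : ∀ i j, ContinuousOn (fun t => C t i j) (Icc t₀ (t₀ + T)))
    (hR : ∀ i j, ContinuousOn (fun t => R t i j) (Icc t₀ (t₀ + T)))
    (hQ : ∀ i j, ContinuousOn (fun t => Q t i j) (Icc t₀ (t₀ + T)))
    (hRpd : ∀ t ∈ Icc t₀ (t₀ + T), (R t).PosDef)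
    (hQpd : ∀ t ∈ Icc t₀ (t₀ + T), (Q t).PosDef)
    -- `Φ` is the state transition matrix: `∂Φ(t,τ)/∂t = A(t)Φ(t,τ)`, `Φ(τ,τ) = 1`
    (Φ : ℝ → ℝ → Matrix (Fin n) (Fin n) ℝ)
    (hΦid : ∀ τ ∈ Icc t₀ (t₀ + T), Φ τ τ = 1)
    (hΦode : ∀ τ ∈ Icc t₀ (t₀ + T), ∀ t ∈ Icc t₀ (t₀ + T), ∀ i j,
      HasDerivWithinAt (fun s => Φ s τ i j) ((A t * Φ t τ) i j) (Icc t₀ (t₀ + T)) t)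
    -- the fixed time `t̄ ∈ Ω`
    (tb : ℝ) (htb : tb ∈ Icc t₀ (t₀ + T))
    -- the weighted reachability Gramian at `t̄`
    (W : Matrix (Fin n) (Fin n) ℝ)
    (hW : ∀ i j, W i j =
      ∫ τ in t₀..tb, (Φ tb τ * G τ * (R τ)⁻¹ * (G τ)ᵀ * (Φ tb τ)ᵀ) i j)
    -- `Qs` is the symmetric positive definite square root of `Q t̄`
    (Qs : Matrix (Fin m) (Fin m) ℝ)
    (hQs : Qs.PosDef ∧ Qs * Qs = Q tb)
    (hHerm : (Qs * C tb * W * (C tb)ᵀ * Qs).IsHermitian) :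
    -- the supremum of the weighted output energy over the admissible inputs is
    -- `λ_max(Q^{1/2} C W Cᵀ Q^{1/2})` and it is attained
    IsGreatest
      {v : ℝ | ∃ w : ℝ → Fin r → ℝ, Measurable w ∧
        IntervalIntegrable (fun τ => w τ ⬝ᵥ (R τ *ᵥ w τ)) volume t₀ (t₀ + T) ∧
        (∫ τ in t₀..(t₀ + T), w τ ⬝ᵥ (R τ *ᵥ w τ)) ≤ 1 ∧
        IntervalIntegrable (fun τ => Φ tb τ *ᵥ (G τ *ᵥ w τ)) volume t₀ tb ∧
        v = (C tb *ᵥ ∫ τ in t₀..tb, Φ tb τ *ᵥ (G τ *ᵥ w τ)) ⬝ᵥ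
              (Q tb *ᵥ (C tb *ᵥ ∫ τ in t₀..tb, Φ tb τ *ᵥ (G τ *ᵥ w τ)))}
      (⨆ i, hHerm.eigenvalues i) := by
  have hΦ : ContinuousOn (fun τ => Φ tb τ) (Icc t₀ (t₀ + T)) :=
    aux_trans (by linarith) hA Φ hΦid hΦode htb
  have hQT : Qsᵀ = Qs := by
    have := hQs.1.isHermitian.eq
    rwa [conjTranspose_eq_transpose_of_trivial] at this
  have hD : Qs * C tb * W * (C tb)ᵀ * Qs = (Qs * C tb) * W * (Qs * C tb)ᵀ := by
    rw [transpose_mul, hQT]; simp only [Matrix.mul_assoc]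
  have core := aux_core hm htb (B := fun τ => Φ tb τ * G τ) (R := R)
    (aux_mul hΦ (aux_entries hG)) (aux_entries hR) hRpd W
    (by intro i j; rw [hW]; simp only [transpose_mul, Matrix.mul_assoc]) (Qs * C tb)
    (hD ▸ hHerm)
  have hev : hHerm.eigenvalues = (show ((Qs * C tb) * W * (Qs * C tb)ᵀ).IsHermitian from hD ▸ hHerm).eigenvalues := by
    congr 1
  have hE : ∀ x : Fin n → ℝ, (C tb *ᵥ x) ⬝ᵥ (Q tb *ᵥ (C tb *ᵥ x)) =
      ((Qs * C tb) *ᵥ x) ⬝ᵥ ((Qs * C tb) *ᵥ x) := by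
    intro x
    rw [← hQs.2, ← mulVec_mulVec, ← mulVec_mulVec, dotProduct_mulVec, ← mulVec_transpose, hQT]
  rw [hev]
  simp only [hE]
  simp only [mulVec_mulVec] at core ⊢
  exact core
end
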